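/- arXiv:0808.2822 — 2 statements merged into one kernel-verified Lean document; each statement's English description precedes it below -/
import Mathlib

section
/- For every n ≥ 1 and every integer k, the number of Dyck paths of type B_n with type B major index k equals the number of signed permutations σ ∈ NC(B_n) with maj_B(rev(σ)) + imaj_B(rev(σ)) = k; equivalently, Σ_w q^{maj(w)} = Σ_{σ ∈ NC(B_n)} q^{maj_B(rev(σ)) + imaj_B(rev(σ))}, the left sum being over all Dyck paths w of type B_n. -/
open scoped Classical

namespace Stmt

/-- Number of north steps (`true`) among the first `k` steps of the path `w`. -/
def countN {m : ℕ} (w : Fin m → Bool) (k : ℕ) : ℕ :=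
  (Finset.univ.filter (fun t : Fin m => (t : ℕ) < k ∧ w t = true)).card

/-- Number of east steps (`false`) among the first `k` steps of the path `w`. -/
def countE {m : ℕ} (w : Fin m → Bool) (k : ℕ) : ℕ :=
  (Finset.univ.filter (fun t : Fin m => (t : ℕ) < k ∧ w t = false)).card

/-- A Dyck path of length `n`: `n` north and `n` east steps, every prefix has
at least as many north as east steps. -/
def IsDyckA (n : ℕ) (w : Fin (2 * n) → Bool) : Prop :=
  countN w (2 * n) = n ∧ ∀ k : ℕ, countE w k ≤ countN w k

/-- A Dyck path of type `B_n`: `2n` steps, every prefix has at least as many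
north as east steps. -/
def IsDyckB (n : ℕ) (w : Fin (2 * n) → Bool) : Prop :=
  ∀ k : ℕ, countE w k ≤ countN w k

/-- The unit cell `[i-1,i] × [j-1,j]` lies below the lattice path `w`:
at some time the path has `x`-coordinate `< i` and `y`-coordinate `≥ j`. -/
def CellBelow {m : ℕ} (w : Fin m → Bool) (i j : ℕ) : Prop :=
  ∃ k : ℕ, countE w k < i ∧ j ≤ countN w k

/-- Area of a (type `A`) Dyck path: number of cells `b_{i,j}` with `i < j`
lying below the path. -/
noncomputable def areaA {m : ℕ} (w : Fin m → Bool) : ℕ :=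
  {p : ℕ × ℕ | 1 ≤ p.1 ∧ p.1 < p.2 ∧ CellBelow w p.1 p.2}.ncard

/-- Area of a type `B_n` Dyck path: number of cells `b_{i,j}` with
`1 ≤ i < j ≤ 2n+1-i` lying below the path. -/
noncomputable def areaB (n : ℕ) (w : Fin (2 * n) → Bool) : ℕ :=
  {p : ℕ × ℕ | 1 ≤ p.1 ∧ p.1 < p.2 ∧ p.2 ≤ 2 * n + 1 - p.1 ∧
    CellBelow w p.1 p.2}.ncard

/-- Descent set of a path, 1-indexed: positions `i` with `w_i = E`, `w_{i+1} = N`. -/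
def pathDes {m : ℕ} (w : Fin m → Bool) : Finset ℕ :=
  (Finset.Ioo 0 m).filter (fun i =>
    ∃ h : i < m, w ⟨i - 1, Nat.lt_of_le_of_lt (Nat.sub_le i 1) h⟩ = false ∧ w ⟨i, h⟩ = true)

def desPath {m : ℕ} (w : Fin m → Bool) : ℕ := (pathDes w).card

/-- Major index of a Dyck path of length `n`: `maj(w) = ∑_{i ∈ Des(w)} (2n - i)`. -/
def majA (n : ℕ) (w : Fin (2 * n) → Bool) : ℕ :=
  ∑ i ∈ pathDes w, (2 * n - i)

/-- Number of east steps of a path. -/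
def negPath {m : ℕ} (w : Fin m → Bool) : ℕ :=
  (Finset.univ.filter (fun t : Fin m => w t = false)).card

/-- Type `B` major index: `maj(w) = 2 ⬝ (neg(w) + ∑_{i ∈ Des(w)} (2n - i))`. -/
def majB (n : ℕ) (w : Fin (2 * n) → Bool) : ℕ :=
  2 * (negPath w + ∑ i ∈ pathDes w, (2 * n - i))

/-- A signed permutation of rank `n`, encoded as a permutation of `ℤ` that is
odd (`σ(-x) = -σ(x)`) and fixes every point outside `{±1,…,±n}`. -/
def IsSignedPerm (n : ℕ) (σ : Equiv.Perm ℤ) : Prop :=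
  (∀ x : ℤ, σ (-x) = -σ x) ∧ ∀ x : ℤ, ¬(1 ≤ |x| ∧ |x| ≤ (n : ℤ)) → σ x = x

/-- `x` belongs to the ground set `{±1,…,±n}`. -/
def InB (n : ℕ) (x : ℤ) : Prop := 1 ≤ |x| ∧ |x| ≤ (n : ℤ)

/-- Position of `x` in the total order `-1 < -2 < ⋯ < -n < 1 < 2 < ⋯ < n`. -/
def bKey (n : ℕ) (x : ℤ) : ℤ := if x < 0 then -x else x + (n : ℤ)

/-- `σ` maps each element of every orbit to the cyclically next element of
that orbit with respect to the order `-1 < -2 < ⋯ < -n < 1 < ⋯ < n`. -/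
def IncCyclesB (n : ℕ) (σ : Equiv.Perm ℤ) : Prop :=
  ∀ x : ℤ, InB n x →
    ((∃ y, σ.SameCycle x y ∧ bKey n x < bKey n y) →
      bKey n x < bKey n (σ x) ∧
        ∀ y, σ.SameCycle x y → bKey n x < bKey n y → bKey n (σ x) ≤ bKey n y) ∧
    ((∀ y, σ.SameCycle x y → bKey n y ≤ bKey n x) →
      ∀ y, σ.SameCycle x y → bKey n (σ x) ≤ bKey n y)

/-- No two distinct orbits of `σ` cross, with respect to the order
`-1 < -2 < ⋯ < -n < 1 < ⋯ < n`. -/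
def NoCrossingB (n : ℕ) (σ : Equiv.Perm ℤ) : Prop :=
  ¬ ∃ a b c d : ℤ, InB n a ∧ InB n b ∧ InB n c ∧ InB n d ∧
      bKey n a < bKey n b ∧ bKey n b < bKey n c ∧ bKey n c < bKey n d ∧
      σ.SameCycle a c ∧ σ.SameCycle b d ∧ ¬σ.SameCycle a b

/-- At most one orbit `B` satisfies `B = -B`. -/
def AtMostOneSym (n : ℕ) (σ : Equiv.Perm ℤ) : Prop :=
  ∀ x y : ℤ, InB n x → InB n y → σ.SameCycle x (-x) → σ.SameCycle y (-y) →
    σ.SameCycle x y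

/-- Non-crossing "partitions" of type `B_n`, as signed permutations whose orbits
form a non-crossing type `B_n` set partition, each element being mapped to the
cyclically next element of its orbit. -/
def IsNCB (n : ℕ) (σ : Equiv.Perm ℤ) : Prop :=
  IsSignedPerm n σ ∧ IncCyclesB n σ ∧ NoCrossingB n σ ∧ AtMostOneSym n σ

/-- One-line notation `(σ(1),…,σ(n))` of a signed permutation. -/
def word (n : ℕ) (σ : Equiv.Perm ℤ) : Fin n → ℤ := fun i => σ ((i : ℤ) + 1)

/-- Positions of the negative entries of an integer word. -/
def negSetW {n : ℕ} (f : Fin n → ℤ) : Finset (Fin n) :=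
  Finset.univ.filter (fun i => f i < 0)

/-- Number of inversions of an integer word. -/
def invW {n : ℕ} (f : Fin n → ℤ) : ℕ :=
  (Finset.univ.filter (fun p : Fin n × Fin n => p.1 < p.2 ∧ f p.2 < f p.1)).card

/-- Coxeter length of a signed permutation with one-line notation `f`:
`l_S = inv(f) - ∑_{i ∈ Neg(f)} f i`. -/
def lSW {n : ℕ} (f : Fin n → ℤ) : ℤ :=
  (invW f : ℤ) - ∑ i ∈ negSetW f, f i

/-- Major index of an integer word: sum of the (1-indexed) descent positions. -/
def majW {n : ℕ} (f : Fin n → ℤ) : ℕ :=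
  ∑ i ∈ Finset.univ.filter
      (fun i : Fin n => ∃ h : (i : ℕ) + 1 < n, f ⟨(i : ℕ) + 1, h⟩ < f i),
    ((i : ℕ) + 1)

/-- Type `B` major index of a signed permutation with one-line notation `f`:
`maj_B = 2 ⬝ maj(f) + neg(f)`. -/
def majBW {n : ℕ} (f : Fin n → ℤ) : ℕ := 2 * majW f + (negSetW f).card

/-- One-line notation of the inverse of the signed permutation with one-line
notation `f` (the sum picks out the unique matching position). -/
def wInv {n : ℕ} (f : Fin n → ℤ) : Fin n → ℤ :=
  fun j => ∑ i : Fin n,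
    if f i = (j : ℤ) + 1 then (i : ℤ) + 1
    else if f i = -((j : ℤ) + 1) then -((i : ℤ) + 1) else 0

/-- `imaj_B` of the signed permutation with one-line notation `f`. -/
def imajBW {n : ℕ} (f : Fin n → ℤ) : ℕ := majBW (wInv f)

/-- One-line notation of `rev σ`: the subsequence of negative entries is
reversed in place (the sum picks the entry at the mirrored negative position). -/
def revW {n : ℕ} (f : Fin n → ℤ) : Fin n → ℤ :=
  fun i =>
    if 0 ≤ f i then f i
    else
      ∑ j : Fin n,
        if f j < 0 ∧
            (Finset.univ.filter (fun t : Fin n => f t < 0 ∧ t ≤ i)).card =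
              (Finset.univ.filter (fun t : Fin n => f t < 0 ∧ j ≤ t)).card
          then f j else 0

/-- Gaussian binomial coefficients evaluated at `t`, with integer lower index. -/
noncomputable def gaussBinom (t : ℚ) : ℕ → ℤ → ℚ
  | 0, r => if r = 0 then 1 else 0
  | L + 1, r => gaussBinom t L (r - 1) + t ^ r * gaussBinom t L r

lemma gaussBinom_succ' {t : ℚ} (ht : t ≠ 0) (L : ℕ) (r : ℤ) :
    gaussBinom t (L + 1) r =
      gaussBinom t L r + t ^ ((L : ℤ) + 1 - r) * gaussBinom t L (r - 1) := by
  induction L generalizing r with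
  | zero =>
    simp only [gaussBinom]
    by_cases h0 : r = 0
    · subst h0; simp
    · by_cases h1 : r = 1
      · subst h1; simp
      · have : r - 1 ≠ 0 := by omega
        simp [h0, this]
  | succ L ih =>
    have e1 := ih r
    have e2 := ih (r - 1)
    have a : gaussBinom t (L + 1 + 1) r =
      gaussBinom t (L + 1) (r - 1) + t ^ r * gaussBinom t (L + 1) r := rfl
    have b : gaussBinom t (L + 1) r =
      gaussBinom t L (r - 1) + t ^ r * gaussBinom t L r := rfl
    have c : gaussBinom t (L + 1) (r - 1) =
      gaussBinom t L (r - 1 - 1) + t ^ (r - 1) * gaussBinom t L (r - 1) := rfl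
    rw [a]
    have h1 : t ^ r * t ^ ((L : ℤ) + 1 - r) = t ^ ((L : ℤ) + 1) := by
      rw [← zpow_add₀ ht]; congr 1; ring
    have h2 : t ^ (((L + 1 : ℕ) : ℤ) + 1 - r) * t ^ (r - 1) = t ^ ((L : ℤ) + 1) := by
      rw [← zpow_add₀ ht]; congr 1; push_cast; ring
    have h3 : t ^ ((L : ℤ) + 1 - (r - 1)) = t ^ (((L + 1 : ℕ) : ℤ) + 1 - r) := by
      congr 1; push_cast; ring
    rw [h3] at e2
    calc gaussBinom t (L + 1) (r - 1) + t ^ r * gaussBinom t (L + 1) r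
        = (gaussBinom t L (r - 1) + t ^ (((L + 1 : ℕ) : ℤ) + 1 - r) * gaussBinom t L (r - 1 - 1))
          + t ^ r * (gaussBinom t L r + t ^ ((L : ℤ) + 1 - r) * gaussBinom t L (r - 1)) := by
            rw [← e1, ← e2]
      _ = gaussBinom t L (r - 1) + t ^ (((L + 1 : ℕ) : ℤ) + 1 - r) * gaussBinom t L (r - 1 - 1)
          + t ^ r * gaussBinom t L r
          + (t ^ r * t ^ ((L : ℤ) + 1 - r)) * gaussBinom t L (r - 1) := by ring
      _ = gaussBinom t (L + 1) r
          + t ^ (((L + 1 : ℕ) : ℤ) + 1 - r) * gaussBinom t (L + 1) (r - 1) := by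
            rw [b, c, h1, ← h2]; ring

lemma gaussBinom_inv {t : ℚ} (ht : t ≠ 0) (L : ℕ) (r : ℤ) :
    t ^ (r * (L - r)) * gaussBinom t⁻¹ L r = gaussBinom t L r := by
  induction L generalizing r with
  | zero =>
    simp only [gaussBinom]
    by_cases h0 : r = 0
    · subst h0; simp
    · simp [h0]
  | succ L ih =>
    rw [gaussBinom_succ' ht, ← ih r, ← ih (r - 1)]
    simp only [gaussBinom, inv_zpow', mul_add, ← mul_assoc, ← zpow_add₀ ht]
    rw [add_comm]
    congr 3 <;> push_cast <;> ring

lemma gaussBinom_three_term {t : ℚ} (ht : t ≠ 0) (L : ℕ) (r : ℤ) :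
    gaussBinom t (L + 2) r = gaussBinom t (L + 1) r + gaussBinom t (L + 1) (r - 1)
      + (t ^ (L + 1) - 1) * gaussBinom t L (r - 1) := by
  have b := gaussBinom_succ' ht (L + 1) r
  have c : gaussBinom t (L + 1) (r - 1) =
      gaussBinom t L (r - 1 - 1) + t ^ (r - 1) * gaussBinom t L (r - 1) := rfl
  have d := gaussBinom_succ' ht L (r - 1)
  have h2 : t ^ (((L + 1 : ℕ) : ℤ) + 1 - r) * t ^ (r - 1) = t ^ (L + 1) := by
    rw [← zpow_add₀ ht, ← zpow_natCast]; congr 1; push_cast; ring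
  have h3 : t ^ ((L : ℤ) + 1 - (r - 1)) = t ^ (((L + 1 : ℕ) : ℤ) + 1 - r) := by
    congr 1; push_cast; ring
  rw [h3] at d
  rw [show L + 2 = L + 1 + 1 from rfl, b, ← h2]
  linear_combination (t ^ (((L + 1 : ℕ) : ℤ) + 1 - r)) * c - d

/-- The letter of `w` at the (0-indexed) position `q`, with `N` beyond the end. -/
def letterAt {L : ℕ} (w : Fin L → Bool) (q : ℕ) : Bool :=
  if h : q < L then w ⟨q, h⟩ else true

/-- Sum of `L - i` over the peaks of `w`, i.e. over the 1-indexed positions `i`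
with `w_i = N` and `w_{i+1} = E`. -/
def peakSum {L : ℕ} (w : Fin L → Bool) : ℕ :=
  ∑ q ∈ Finset.range L,
    if letterAt w q = true ∧ letterAt w (q + 1) = false then L - 1 - q else 0

/-- The path starting at height `c` above the diagonal stays weakly above it. -/
def BallotFrom {L : ℕ} (c : ℕ) (w : Fin L → Bool) : Prop :=
  ∀ k : ℕ, countE w k ≤ countN w k + c

lemma letterAt_cons_zero {L : ℕ} (a : Bool) (w : Fin L → Bool) :
    letterAt (Fin.cons a w : Fin (L + 1) → Bool) 0 = a := by
  simp [letterAt]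

lemma letterAt_cons_succ {L : ℕ} (a : Bool) (w : Fin L → Bool) (q : ℕ) :
    letterAt (Fin.cons a w : Fin (L + 1) → Bool) (q + 1) = letterAt w q := by
  unfold letterAt
  by_cases h : q < L
  · rw [dif_pos h, dif_pos (by omega)]
    exact Fin.cons_succ (α := fun _ => Bool) a w ⟨q, h⟩
  · rw [dif_neg h, dif_neg (by omega)]

lemma peakSum_cons {L : ℕ} (a : Bool) (w : Fin L → Bool) :
    peakSum (Fin.cons a w : Fin (L + 1) → Bool) =
      peakSum w + if a = true ∧ letterAt w 0 = false then L else 0 := by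
  unfold peakSum
  rw [Finset.sum_range_succ']
  simp only [letterAt_cons_succ, letterAt_cons_zero, zero_add]
  congr 1
  apply Finset.sum_congr rfl
  intro q _
  congr 1
  omega

lemma countN_cons_succ {L : ℕ} (a : Bool) (w : Fin L → Bool) (k : ℕ) :
    countN (Fin.cons a w : Fin (L + 1) → Bool) (k + 1) =
      (if a = true then 1 else 0) + countN w k := by
  unfold countN
  rw [Finset.card_filter, Finset.card_filter, Fin.sum_univ_succ]
  simp

lemma countE_cons_succ {L : ℕ} (a : Bool) (w : Fin L → Bool) (k : ℕ) :
    countE (Fin.cons a w : Fin (L + 1) → Bool) (k + 1) =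
      (if a = false then 1 else 0) + countE w k := by
  unfold countE
  rw [Finset.card_filter, Finset.card_filter, Fin.sum_univ_succ]
  simp

lemma countN_zero {L : ℕ} (w : Fin L → Bool) : countN w 0 = 0 := by simp [countN]

lemma countE_zero {L : ℕ} (w : Fin L → Bool) : countE w 0 = 0 := by simp [countE]

lemma ballotFrom_cons {L : ℕ} (c : ℕ) (a : Bool) (w : Fin L → Bool) :
    BallotFrom c (Fin.cons a w : Fin (L + 1) → Bool) ↔
      ∀ k, (if a = false then 1 else 0) + countE w k
        ≤ (if a = true then 1 else 0) + countN w k + c := by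
  constructor
  · intro h k
    have := h (k + 1)
    rwa [countN_cons_succ, countE_cons_succ] at this
  · rintro h (_ | k)
    · simp [countE_zero]
    · rw [countN_cons_succ, countE_cons_succ]; exact h k

lemma ballotFrom_cons_true {L : ℕ} (c : ℕ) (w : Fin L → Bool) :
    BallotFrom c (Fin.cons true w : Fin (L + 1) → Bool) ↔ BallotFrom (c + 1) w := by
  rw [ballotFrom_cons]
  refine forall_congr' fun k => ?_
  simp only [Bool.true_eq_false, if_false, if_true]
  omega

lemma ballotFrom_cons_false {L : ℕ} (c : ℕ) (w : Fin L → Bool) :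
    BallotFrom (c + 1) (Fin.cons false w : Fin (L + 1) → Bool) ↔ BallotFrom c w := by
  rw [ballotFrom_cons]
  refine forall_congr' fun k => ?_
  simp only [Bool.false_eq_true, if_false, if_true]
  omega

lemma not_ballotFrom_zero_cons_false {L : ℕ} (w : Fin L → Bool) :
    ¬ BallotFrom 0 (Fin.cons false w : Fin (L + 1) → Bool) := by
  rw [ballotFrom_cons]
  intro h
  have := h 0
  simp [countE_zero, countN_zero] at this

/-- Generating function of `peakSum` over the words of length `L` that are
ballot from height `c`. -/
noncomputable def ballotGF (t : ℚ) (c L : ℕ) : ℚ :=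
  ∑ w : Fin L → Bool, if BallotFrom c w then t ^ peakSum w else 0

lemma sum_cons {L : ℕ} (F : (Fin (L + 1) → Bool) → ℚ) :
    ∑ w, F w = ∑ w : Fin L → Bool, F (Fin.cons true w) + ∑ w : Fin L → Bool, F (Fin.cons false w) := by
  rw [← (Fin.consEquiv (fun _ : Fin (L + 1) => Bool)).sum_comp, Fintype.sum_prod_type]
  rw [Fintype.sum_bool]
  rfl

/-- Contribution to `ballotGF t (c + 1) L` of the words starting with `E`, the height being that
after this step. -/
lemma sum_ballotFrom_cons_false (t : ℚ) (c L : ℕ) :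
    ∑ w : Fin L → Bool, (if BallotFrom (c + 1) (Fin.cons false w : Fin (L + 1) → Bool) then
      t ^ peakSum (Fin.cons false w : Fin (L + 1) → Bool) else 0) = ballotGF t c L := by
  unfold ballotGF
  refine Finset.sum_congr rfl fun w _ => ?_
  simp only [ballotFrom_cons_false, peakSum_cons, Bool.false_eq_true, false_and, if_false,
    add_zero]

lemma sum_ballotFrom_cons_true (t : ℚ) (c L : ℕ) :
    ∑ w : Fin (L + 1) → Bool, (if BallotFrom c (Fin.cons true w : Fin (L + 2) → Bool) then
      t ^ peakSum (Fin.cons true w : Fin (L + 2) → Bool) else 0) =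
      ballotGF t (c + 1) (L + 1) + (t ^ (L + 1) - 1) * ballotGF t c L := by
  rw [sum_cons, ballotGF, sum_cons]
  refine (congrArg₂ (· + ·) ?_ ?_).trans (add_assoc _ _ _).symm
  · refine Finset.sum_congr rfl fun w _ => ?_
    simp only [ballotFrom_cons_true, peakSum_cons, letterAt_cons_zero, Bool.true_eq_false,
      and_false, if_false, add_zero]
  · rw [ballotGF, Finset.mul_sum, ← Finset.sum_add_distrib]
    refine Finset.sum_congr rfl fun w _ => ?_
    simp only [ballotFrom_cons_true, ballotFrom_cons_false, peakSum_cons, letterAt_cons_zero,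
      and_self, if_true, Bool.false_eq_true, false_and, if_false, add_zero]
    split_ifs
    · ring
    · ring

lemma ballotGF_zero_add_two (t : ℚ) (L : ℕ) :
    ballotGF t 0 (L + 2) =
      ballotGF t 1 (L + 1) + (t ^ (L + 1) - 1) * ballotGF t 0 L := by
  rw [ballotGF, sum_cons, sum_ballotFrom_cons_true]
  simp [not_ballotFrom_zero_cons_false]

lemma ballotGF_succ_add_two (t : ℚ) (c L : ℕ) :
    ballotGF t (c + 1) (L + 2) = ballotGF t (c + 2) (L + 1) + ballotGF t c (L + 1)
      + (t ^ (L + 1) - 1) * ballotGF t (c + 1) L := by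
  rw [ballotGF, sum_cons, sum_ballotFrom_cons_true, sum_ballotFrom_cons_false]
  ring

lemma ballotGF_length_zero (t : ℚ) (c : ℕ) : ballotGF t c 0 = 1 := by
  have h : ∀ w : Fin 0 → Bool, BallotFrom c w := fun w k => by simp [countE]
  simp [ballotGF, h, peakSum]

lemma ballotGF_length_one (t : ℚ) (c : ℕ) :
    ballotGF t c 1 = if c = 0 then 1 else 2 := by
  have h : ∀ c, ∀ w : Fin 0 → Bool, BallotFrom c w := fun c w k => by simp [countE]
  rw [ballotGF, sum_cons]
  rcases c with _ | c
  · simp [not_ballotFrom_zero_cons_false, ballotFrom_cons_true, h, peakSum_cons]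
    simp [peakSum]
  · simp [ballotFrom_cons_false, ballotFrom_cons_true, h, peakSum_cons]
    simp [peakSum]; norm_num

lemma ballotGF_eq {t : ℚ} (ht : t ≠ 0) (c L : ℕ) :
    ballotGF t c L =
      ∑ s ∈ Finset.range (c + 1), gaussBinom t L (((L + c) / 2 : ℕ) - (s : ℤ)) := by
  induction L using Nat.twoStepInduction generalizing c with
  | zero =>
    rw [ballotGF_length_zero]
    simp only [gaussBinom]
    rw [Finset.sum_eq_single_of_mem (c / 2)]
    · simp
    · simp; omega
    · intro b _ hb
      rw [if_neg (by simp; omega)]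
  | one =>
    rw [ballotGF_length_one]
    have h1 : ∀ r : ℤ, gaussBinom t 1 r = (if r = 1 then 1 else 0) + if r = 0 then 1 else 0 := by
      intro r
      have e : (r - 1 = 0) ↔ r = 1 := by omega
      simp only [gaussBinom, e]
      by_cases h : r = 0
      · subst h; simp
      · simp [h]
    simp only [h1, Finset.sum_add_distrib]
    rw [Finset.sum_eq_single_of_mem (f := fun s : ℕ => if (((1 + c) / 2 : ℕ) - (s : ℤ)) = 0
      then (1 : ℚ) else 0) ((1 + c) / 2) (by simp; omega)
      (fun b _ hb => if_neg (by omega))]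
    rcases c with _ | c
    · simp
    · rw [if_neg (Nat.succ_ne_zero c),
        Finset.sum_eq_single_of_mem (f := fun s : ℕ => if (((1 + (c + 1)) / 2 : ℕ) - (s : ℤ)) = 1
        then (1 : ℚ) else 0) ((1 + (c + 1)) / 2 - 1) (by simp; omega)
        (fun b _ hb => if_neg (by omega)), if_pos (by omega), if_pos (by omega)]
      norm_num
  | more L ih1 ih2 =>
    simp only [gaussBinom_three_term ht L]
    rw [Finset.sum_add_distrib, ← Finset.mul_sum]
    have e1 : ∀ s : ℕ, (((L + 2 + c) / 2 : ℕ) : ℤ) - s - 1 = ((L + c) / 2 : ℕ) - s := by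
      intro s; omega
    simp only [e1, ← ih1 c]
    rcases c with _ | c
    · rw [ballotGF_zero_add_two, ih2 1]
      have e2 : ((L + 1 + 1) / 2 : ℕ) - ((1 : ℕ) : ℤ) = ((L + 0) / 2 : ℕ) - ((0 : ℕ) : ℤ) := by
        omega
      simp only [Finset.sum_range_succ, Finset.sum_range_zero]
      rw [e2, show L + 1 + 1 = L + 2 + 0 from rfl]
      ring
    · rw [ballotGF_succ_add_two, ih2 (c + 2), ih2 c, Finset.sum_add_distrib,
        Finset.sum_range_succ (n := c + 1 + 1), Finset.sum_range_succ (n := c + 1)]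
      have e2 : L + 1 + (c + 2) = L + 2 + (c + 1) := by omega
      have e3 : L + 1 + c = L + (c + 1) := by omega
      have e4 : ((L + 2 + (c + 1)) / 2 : ℕ) - ((c + 1 + 1 : ℕ) : ℤ)
        = ((L + (c + 1)) / 2 : ℕ) - ((c + 1 : ℕ) : ℤ) := by omega
      rw [e2, e3, e4, Finset.sum_range_succ _ (c + 1)]
      simp only [Finset.sum_range_succ _ (c + 1)]
      ring

lemma ballotGF_two_mul {t : ℚ} (ht : t ≠ 0) (n : ℕ) :
    ballotGF t 0 (2 * n) = gaussBinom t (2 * n) n := by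
  rw [ballotGF_eq ht]
  simp

lemma ballotGF_inv {t : ℚ} (ht : t ≠ 0) (n : ℕ) :
    t ^ (n ^ 2) * ballotGF t⁻¹ 0 (2 * n) = ballotGF t 0 (2 * n) := by
  rw [ballotGF_two_mul ht, ballotGF_two_mul (inv_ne_zero ht), ← gaussBinom_inv ht]
  congr 1
  rw [← zpow_natCast]
  congr 1
  push_cast
  ring

/-- The statistic `peakSum` is symmetrically distributed about `n ^ 2 / 2` on the Dyck paths
of type `B_n`. -/
lemma card_peakSum_symm {n : ℕ}
    (hle : ∀ w : Fin (2 * n) → Bool, IsDyckB n w → peakSum w ≤ n ^ 2)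
    (k : ℕ) :
    (Finset.univ.filter fun w : Fin (2 * n) → Bool => IsDyckB n w ∧ peakSum w = k).card =
      (Finset.univ.filter fun w : Fin (2 * n) → Bool =>
        IsDyckB n w ∧ n ^ 2 - peakSum w = k).card := by
  set D := Finset.univ.filter fun w : Fin (2 * n) → Bool => IsDyckB n w with hD
  have hP : ∑ w ∈ D, (Polynomial.X : Polynomial ℚ) ^ peakSum w =
      ∑ w ∈ D, (Polynomial.X : Polynomial ℚ) ^ (n ^ 2 - peakSum w) := by
    apply Polynomial.eq_of_infinite_eval_eq
    refine (Set.Finite.infinite_compl (Set.finite_singleton (0 : ℚ))).mono fun t ht => ?_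
    have ht : t ≠ 0 := ht
    have h1 : ∀ t : ℚ, ballotGF t 0 (2 * n) = ∑ w ∈ D, t ^ peakSum w := by
      intro t
      rw [ballotGF, hD, Finset.sum_filter]
      rfl
    simp only [Set.mem_ofPred_eq, Polynomial.eval_finsetSum, Polynomial.eval_pow,
      Polynomial.eval_X]
    rw [← h1, ← ballotGF_inv ht, h1, Finset.mul_sum]
    refine Finset.sum_congr rfl fun w hw => ?_
    have hw : IsDyckB n w := by simpa [hD] using hw
    rw [inv_pow, ← div_eq_mul_inv, pow_sub₀ _ ht (hle w hw), div_eq_mul_inv]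
  have hc := congrArg (fun p => Polynomial.coeff p k) hP
  simp only [Polynomial.finsetSum_coeff, Polynomial.coeff_X_pow, Finset.sum_boole, hD,
    Finset.filter_filter] at hc
  have hc := Nat.cast_injective (R := ℚ) hc
  simpa only [eq_comm] using hc

lemma sum_pathDes {L : ℕ} (w : Fin L → Bool) :
    ∑ i ∈ pathDes w, (L - i) = ∑ q ∈ Finset.range L,
      if letterAt w q = false ∧ letterAt w (q + 1) = true then L - 1 - q else 0 := by
  rcases L with _ | L
  · simp [pathDes]
  rw [Finset.sum_range_succ, pathDes, Finset.sum_filter]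
  simp only [Nat.add_sub_cancel, Nat.sub_self, ite_self, add_zero]
  have e : Finset.Ioo 0 (L + 1) = Finset.Ico (0 + 1) (L + 1) := by ext; simp; omega
  rw [e, Finset.range_eq_Ico, ← Finset.sum_Ico_add' _ 0 L 1]
  refine Finset.sum_congr rfl fun q hq => ?_
  have hq := (Finset.mem_Ico.1 hq).2
  have h1 : letterAt w q = w ⟨q, by omega⟩ := dif_pos _
  have h2 : letterAt w (q + 1) = w ⟨q + 1, by omega⟩ := dif_pos _
  have h3 : q + 1 < L + 1 := by omega
  simp [h1, h2, h3]

lemma negPath_add_sum_pathDes {L : ℕ} (w : Fin L → Bool) :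
    negPath w + ∑ i ∈ pathDes w, (L - i) =
      peakSum w + if letterAt w 0 = false then L else 0 := by
  rw [sum_pathDes]
  induction L with
  | zero => simp [negPath, peakSum]
  | succ L ih =>
    obtain ⟨a, w, rfl⟩ : ∃ a, ∃ w' : Fin L → Bool, w = Fin.cons a w' :=
      ⟨w 0, Fin.tail w, (Fin.cons_self_tail w).symm⟩
    have hneg : negPath (Fin.cons a w : Fin (L + 1) → Bool) =
        (if a = false then 1 else 0) + negPath w := by
      unfold negPath
      rw [Finset.card_filter, Finset.card_filter, Fin.sum_univ_succ]
      simp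
    rw [hneg, peakSum_cons, Finset.sum_range_succ']
    simp only [letterAt_cons_succ, letterAt_cons_zero]
    have ih := ih w
    have e : ∀ q, L + 1 - 1 - (q + 1) = L - 1 - q := by intro q; omega
    simp only [e]
    cases a <;> cases h : letterAt w 0 <;> simp [h] at ih ⊢ <;> omega

lemma majB_eq_two_mul_peakSum {n : ℕ} {w : Fin (2 * n) → Bool} (hw : IsDyckB n w) :
    majB n w = 2 * peakSum w := by
  rw [majB, negPath_add_sum_pathDes]
  rcases n with _ | n
  · simp
  have h1 := hw 1
  by_cases h : letterAt w 0 = false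
  · obtain ⟨a, w', rfl⟩ : ∃ a, ∃ w' : Fin (2 * n + 1) → Bool, w = Fin.cons a w' :=
      ⟨w 0, Fin.tail w, (Fin.cons_self_tail w).symm⟩
    rw [letterAt_cons_zero] at h
    subst h
    exact absurd hw (not_ballotFrom_zero_cons_false w')
  · simp [h]

lemma inB_iff {n : ℕ} {x : ℤ} : InB n x ↔ x ≠ 0 ∧ -(n : ℤ) ≤ x ∧ x ≤ n := by
  unfold InB
  rw [abs_le]
  have : 1 ≤ |x| ↔ x ≠ 0 := by rw [← abs_pos]; rfl
  rw [this]

lemma bKey_injOn {n : ℕ} {x y : ℤ} (hx : InB n x) (hy : InB n y) (h : bKey n x = bKey n y) :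
    x = y := by
  rw [inB_iff] at hx hy
  unfold bKey at h
  split_ifs at h <;> omega

lemma finite_inB (n : ℕ) : {x | InB n x}.Finite := by
  refine (Set.finite_Icc (-(n : ℤ)) n).subset fun x hx => ?_
  have := inB_iff.1 hx
  exact ⟨this.2.1, this.2.2⟩

lemma IsSignedPerm.inB_apply {n : ℕ} {σ : Equiv.Perm ℤ} (hσ : IsSignedPerm n σ) {x : ℤ}
    (hx : InB n x) : InB n (σ x) := by
  by_contra h
  have := hσ.2 (σ x) h
  exact h ((σ.injective this).symm ▸ hx)

lemma IsSignedPerm.apply_ne_zero {n : ℕ} {σ : Equiv.Perm ℤ} (hσ : IsSignedPerm n σ) {x : ℤ}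
    (hx : x ≠ 0) : σ x ≠ 0 := by
  intro h
  have h0 := hσ.1 0
  have h0 : σ 0 = 0 := by rw [neg_zero] at h0; omega
  exact hx (σ.injective (h.trans h0.symm))

/-- A finite set stable under a permutation is a union of orbits. -/
lemma SameCycle.mem_of_mapsTo {σ : Equiv.Perm ℤ} {S : Set ℤ} (hS : S.Finite)
    (h : Set.MapsTo σ S S) {x y : ℤ} (hxy : σ.SameCycle x y) (hx : x ∈ S) : y ∈ S := by
  have : Finite S := hS
  have h' : Set.MapsTo σ.symm S S := Equiv.Perm.perm_symm_mapsTo_of_mapsTo σ h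
  obtain ⟨i, rfl⟩ := hxy
  induction i using Int.induction_on with
  | zero => simpa
  | succ i ih =>
    rw [add_comm, zpow_add, zpow_one, Equiv.Perm.mul_apply]
    exact h ih
  | pred i ih =>
    rw [sub_eq_add_neg, add_comm, zpow_add, zpow_neg_one, Equiv.Perm.mul_apply]
    exact h' ih

/-- In terms of the positions in the order `-1 < ⋯ < -n < 1 < ⋯ < n`: the arcs `x → σ x` are
nested or disjoint. -/
def Nested (n : ℕ) (σ : Equiv.Perm ℤ) : Prop :=
  ∀ x y, InB n x → InB n y →
    (bKey n x < bKey n y → bKey n y < bKey n (σ x) →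
      bKey n x < bKey n (σ y) ∧ bKey n (σ y) < bKey n (σ x)) ∧
    (bKey n (σ x) ≤ bKey n y → bKey n y ≤ bKey n x →
      bKey n (σ x) ≤ bKey n (σ y) ∧ bKey n (σ y) ≤ bKey n x)

section Nested

variable {n : ℕ} {σ : Equiv.Perm ℤ}

lemma inB_of_sameCycle (hσ : IsSignedPerm n σ) {x y : ℤ} (hx : InB n x)
    (h : σ.SameCycle x y) : InB n y :=
  SameCycle.mem_of_mapsTo (finite_inB n) (fun _ h => hσ.inB_apply h) h hx

lemma Nested.sameCycle_Ioo (hσ : IsSignedPerm n σ) (h : Nested n σ) {x y z : ℤ} (hx : InB n x)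
    (hy : InB n y) (h1 : bKey n x < bKey n y) (h2 : bKey n y < bKey n (σ x))
    (hyz : σ.SameCycle y z) : bKey n x < bKey n z ∧ bKey n z < bKey n (σ x) :=
  (SameCycle.mem_of_mapsTo (S := {y | InB n y ∧ bKey n x < bKey n y ∧ bKey n y < bKey n (σ x)})
    ((finite_inB n).subset fun _ h => h.1)
    (fun y hy => ⟨hσ.inB_apply hy.1, (h x y hx hy.1).1 hy.2.1 hy.2.2⟩) hyz ⟨hy, h1, h2⟩).2

lemma Nested.sameCycle_Icc (hσ : IsSignedPerm n σ) (h : Nested n σ) {x y z : ℤ} (hx : InB n x)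
    (hy : InB n y) (h1 : bKey n (σ x) ≤ bKey n y) (h2 : bKey n y ≤ bKey n x)
    (hyz : σ.SameCycle y z) : bKey n (σ x) ≤ bKey n z ∧ bKey n z ≤ bKey n x :=
  (SameCycle.mem_of_mapsTo (S := {y | InB n y ∧ bKey n (σ x) ≤ bKey n y ∧ bKey n y ≤ bKey n x})
    ((finite_inB n).subset fun _ h => h.1)
    (fun y hy => ⟨hσ.inB_apply hy.1, (h x y hx hy.1).2 hy.2.1 hy.2.2⟩) hyz ⟨hy, h1, h2⟩).2

lemma Nested.incCyclesB (hσ : IsSignedPerm n σ) (h : Nested n σ) : IncCyclesB n σ := by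
  intro x hx
  refine ⟨?_, fun hmax y hxy => ?_⟩
  · rintro ⟨y, hxy, hlt⟩
    have h1 : bKey n x < bKey n (σ x) := by
      by_contra! hle
      have := (h.sameCycle_Icc hσ hx hx hle le_rfl hxy).2
      omega
    refine ⟨h1, fun z hxz hlt => ?_⟩
    by_contra! hz
    have := (h.sameCycle_Ioo hσ hx (inB_of_sameCycle hσ hx hxz) hlt hz hxz.symm).1
    omega
  · exact (h.sameCycle_Icc hσ hx hx (hmax _ (Equiv.Perm.sameCycle_apply_right.2
      (Equiv.Perm.SameCycle.refl _ _))) le_rfl hxy).1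

lemma Nested.noCrossingB (hσ : IsSignedPerm n σ) (h : Nested n σ) : NoCrossingB n σ := by
  rintro ⟨a, b, c, d, ha, hb, hc, hd, hab, hbc, hcd, hac, hbd, hnab⟩
  obtain ⟨x, ⟨hx, hax, hxb⟩, hmax⟩ := Set.exists_max_image
    {z | InB n z ∧ σ.SameCycle a z ∧ bKey n z < bKey n b} (bKey n)
    ((finite_inB n).subset fun _ h => h.1) ⟨a, ha, Equiv.Perm.SameCycle.refl _ _, hab⟩
  obtain ⟨hlt, -⟩ := (h.incCyclesB hσ x hx).1 ⟨c, hax.symm.trans hac, by omega⟩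
  have hσx : bKey n b < bKey n (σ x) := by
    have hs : σ.SameCycle a (σ x) := Equiv.Perm.sameCycle_apply_right.2 hax
    rcases lt_trichotomy (bKey n b) (bKey n (σ x)) with h1 | h1 | h1
    · exact h1
    · exact absurd (bKey_injOn hb (hσ.inB_apply hx) h1 ▸ hs) hnab
    · have := hmax _ ⟨hσ.inB_apply hx, hs, h1⟩
      omega
  have hd' := (h.sameCycle_Ioo hσ hx hb hxb hσx hbd).2
  have := (h.sameCycle_Ioo hσ hx hc (by omega) (by omega) (hac.symm.trans hax)).1
  omega

lemma NoCrossingB.atMostOneSym (h : NoCrossingB n σ) :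
    AtMostOneSym n σ := by
  have key : ∀ a b : ℤ, 1 ≤ a → a < b → b ≤ n → σ.SameCycle a (-a) → σ.SameCycle b (-b) →
      σ.SameCycle a b := by
    intro a b ha hab hb ha' hb'
    by_contra hn
    refine h ⟨-a, -b, a, b, inB_iff.2 (by omega), inB_iff.2 (by omega), inB_iff.2 (by omega),
      inB_iff.2 (by omega), ?_, ?_, ?_, ha'.symm, hb'.symm, fun hs => ?_⟩
    · unfold bKey; split_ifs <;> omega
    · unfold bKey; split_ifs <;> omega
    · unfold bKey; split_ifs <;> omega
    · exact hn (ha'.trans (hs.trans hb'.symm))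
  have key' : ∀ a b : ℤ, 1 ≤ a → a ≤ n → 1 ≤ b → b ≤ n → σ.SameCycle a (-a) →
      σ.SameCycle b (-b) → σ.SameCycle a b := by
    intro a b ha han hb hbn ha' hb'
    rcases lt_trichotomy a b with h1 | h1 | h1
    · exact key a b ha h1 hbn ha' hb'
    · rw [h1]
    · exact (key b a hb h1 han hb' ha').symm
  have pos : ∀ x : ℤ, InB n x → σ.SameCycle x (-x) →
      ∃ a : ℤ, 1 ≤ a ∧ a ≤ n ∧ σ.SameCycle a (-a) ∧ σ.SameCycle x a := by
    intro x hx hs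
    rw [inB_iff] at hx
    rcases lt_or_gt_of_ne hx.1 with h1 | h1
    · exact ⟨-x, by omega, by omega, by rw [neg_neg]; exact hs.symm, hs⟩
    · exact ⟨x, by omega, by omega, hs, Equiv.Perm.SameCycle.refl _ _⟩
  intro x y hx hy hxs hys
  obtain ⟨a, ha1, ha2, ha3, ha4⟩ := pos x hx hxs
  obtain ⟨b, hb1, hb2, hb3, hb4⟩ := pos y hy hys
  exact ha4.trans ((key' a b ha1 ha2 hb1 hb2 ha3 hb3).trans hb4.symm)

lemma nested_of_incCyclesB_of_noCrossingB (hσ : IsSignedPerm n σ) (hi : IncCyclesB n σ)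
    (hc : NoCrossingB n σ) : Nested n σ := by
  intro x y hx hy
  have hxs : σ.SameCycle x (σ x) := Equiv.Perm.sameCycle_apply_right.2
    (Equiv.Perm.SameCycle.refl _ _)
  have hys : σ.SameCycle y (σ y) := Equiv.Perm.sameCycle_apply_right.2
    (Equiv.Perm.SameCycle.refl _ _)
  have hσx := hσ.inB_apply hx
  have hσy := hσ.inB_apply hy
  have ne : ¬ σ.SameCycle x y → bKey n x ≠ bKey n (σ y) ∧ bKey n (σ x) ≠ bKey n (σ y) ∧
      bKey n (σ x) ≠ bKey n y ∧ bKey n x ≠ bKey n y := by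
    intro hn
    refine ⟨fun h => hn ?_, fun h => hn ?_, fun h => hn ?_, fun h => hn ?_⟩
    · rw [bKey_injOn hx hσy h]; exact hys.symm
    · exact hxs.trans (bKey_injOn hσx hσy h ▸ hys.symm)
    · exact bKey_injOn hσx hy h ▸ hxs
    · rw [bKey_injOn hx hy h]
  constructor
  · intro h1 h2
    have hn : ¬ σ.SameCycle x y := by
      intro hs
      have := ((hi x hx).1 ⟨y, hs, h1⟩).2 y hs h1
      omega
    obtain ⟨n1, n2, -, -⟩ := ne hn
    by_contra hcon
    rcases lt_or_gt_of_ne n1 with h3 | h3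
    · exact hc ⟨x, y, σ x, σ y, hx, hy, hσx, hσy, h1, h2, by omega, hxs, hys, hn⟩
    · exact hc ⟨σ y, x, y, σ x, hσy, hx, hy, hσx, h3, h1, h2, hys.symm, hxs,
        fun h => hn (hys.trans h).symm⟩
  · intro h1 h2
    have hmax : ∀ z, σ.SameCycle x z → bKey n z ≤ bKey n x := by
      intro z hz
      by_contra! hlt
      have := ((hi x hx).1 ⟨z, hz, hlt⟩).1
      omega
    by_cases hs : σ.SameCycle x y
    · have hs' := Equiv.Perm.sameCycle_apply_right.2 hs
      exact ⟨(hi x hx).2 hmax _ hs', hmax _ hs'⟩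
    · obtain ⟨n1, n2, n3, n4⟩ := ne hs
      by_contra hcon
      rcases lt_or_gt_of_ne n1 with h3 | h3
      · exact hc ⟨σ x, y, x, σ y, hσx, hy, hx, hσy, by omega, by omega, h3, hxs.symm, hys,
          fun h => hs (hxs.trans h)⟩
      · exact hc ⟨σ y, σ x, y, x, hσy, hσx, hy, hx, by omega, by omega, by omega, hys.symm,
          hxs.symm, fun h => hs (hxs.trans (h.symm.trans hys.symm))⟩

lemma isNCB_iff_nested : IsNCB n σ ↔ IsSignedPerm n σ ∧ Nested n σ :=
  ⟨fun h => ⟨h.1, nested_of_incCyclesB_of_noCrossingB h.1 h.2.1 h.2.2.1⟩,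
    fun h => ⟨h.1, h.2.incCyclesB h.1, h.2.noCrossingB h.1,
      (h.2.noCrossingB h.1).atMostOneSym⟩⟩

end Nested

/-- Non-crossing conditions on a signed permutation in terms of its values at `1, …, n`. -/
structure ArcNC (n : ℕ) (σ : Equiv.Perm ℤ) : Prop where
  signed : IsSignedPerm n σ
  up : ∀ i x, 1 ≤ i → i < x → x < σ i → i < σ x ∧ σ x < σ i
  down : ∀ i x, 0 < σ i → σ i ≤ x → x ≤ i → σ i ≤ σ x ∧ σ x ≤ i
  neg_low : ∀ i x, 1 ≤ i → σ i < 0 → 1 ≤ x → x < -σ i →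
    (1 ≤ σ x ∧ σ x < -σ i) ∨ σ x < -i
  neg_high : ∀ i x, 1 ≤ i → σ i < 0 → i < x → x ≤ n → i < σ x ∨ (σ i < σ x ∧ σ x < 0)

lemma IsSignedPerm.apply_eq_self {n : ℕ} {σ : Equiv.Perm ℤ} (hσ : IsSignedPerm n σ) {x : ℤ}
    (hx : n < x) : σ x = x := by
  apply hσ.2
  have := fun h => (inB_iff (n := n) (x := x)).1 h
  unfold InB at this
  intro h
  have := this h
  omega

lemma IsNCB.arcNC {n : ℕ} {σ : Equiv.Perm ℤ} (h : IsNCB n σ) : ArcNC n σ := by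
  obtain ⟨hσ, h⟩ := isNCB_iff_nested.1 h
  have bd : ∀ i, InB n i → σ i ≠ 0 ∧ -(n : ℤ) ≤ σ i ∧ σ i ≤ n :=
    fun i hi => inB_iff.1 (hσ.inB_apply hi)
  refine ⟨hσ, fun i x h1 h2 h3 => ?_, fun i x h1 h2 h3 => ?_, fun i x h1 h2 h3 h4 => ?_,
    fun i x h1 h2 h3 h4 => ?_⟩
  · by_cases hi : (n : ℤ) < i
    · have := hσ.apply_eq_self hi; omega
    · have hi : InB n i := inB_iff.2 (by omega)
      have := bd i hi
      have hx : InB n x := inB_iff.2 (by omega)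
      have := bd x hx
      have := (h i x hi hx).1
      unfold bKey at this
      split_ifs at this <;> omega
  · by_cases hi : (n : ℤ) < i
    · have := hσ.apply_eq_self hi
      have : x = i := by omega
      subst this
      omega
    · have hi : InB n i := inB_iff.2 (by omega)
      have := bd i hi
      have hx : InB n x := inB_iff.2 (by omega)
      have := bd x hx
      have := (h i x hi hx).2
      unfold bKey at this
      split_ifs at this <;> omega
  · by_cases hi : (n : ℤ) < i
    · have := hσ.apply_eq_self hi; omega
    · have hi : InB n i := inB_iff.2 (by omega)
      have := bd i hi
      have hx : InB n x := inB_iff.2 (by omega)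
      have := bd x hx
      have := (h (-i) x (inB_iff.2 (by omega)) hx).1
      rw [hσ.1] at this
      unfold bKey at this
      split_ifs at this <;> omega
  · have hi : InB n i := inB_iff.2 (by omega)
    have := bd i hi
    have hx : InB n x := inB_iff.2 (by omega)
    have := bd x hx
    have := (h (-i) (-x) (inB_iff.2 (by omega)) (inB_iff.2 (by omega))).1
    rw [hσ.1, hσ.1] at this
    unfold bKey at this
    split_ifs at this <;> omega

lemma ArcNC.isNCB {n : ℕ} {σ : Equiv.Perm ℤ} (h : ArcNC n σ) : IsNCB n σ := by
  have hσ := h.signed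
  refine isNCB_iff_nested.2 ⟨hσ, fun x y hx hy => ?_⟩
  have bx := inB_iff.1 hx
  have bY := inB_iff.1 hy
  have bsx := inB_iff.1 (hσ.inB_apply hx)
  have bsy := inB_iff.1 (hσ.inB_apply hy)
  have ox := hσ.1 x
  have oy := hσ.1 y
  rcases lt_or_gt_of_ne bx.1 with sx | sx <;> rcases lt_or_gt_of_ne bsx.1 with sv | sv
  · have h1 := h.up (-x) (-y)
    have h2 := h.down (-x) (-y)
    rw [ox, oy] at h1 h2
    unfold bKey
    constructor <;> split_ifs <;> omega
  · have h1 := h.neg_low (-x) y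
    have h2 := h.neg_high (-x) (-y)
    rw [ox] at h1
    rw [ox, oy] at h2
    unfold bKey
    constructor <;> split_ifs <;> omega
  · set S : Set ℤ := {y | (1 ≤ -y ∧ y > σ x ∧ InB n y) ∨ (x < y ∧ y ≤ n)} with hS
    have hfin : S.Finite := by
      refine (finite_inB n).subset ?_
      rintro z (hz | hz)
      · exact hz.2.2
      · exact inB_iff.2 (by omega)
    have hmaps : Set.MapsTo σ S S := by
      rintro z hz
      have hz' : InB n z := by
        rcases hz with hz | hz
        · exact hz.2.2
        · exact inB_iff.2 (by omega)
      have b1 := inB_iff.1 (hσ.inB_apply hz')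
      have oz := hσ.1 z
      show (1 ≤ -σ z ∧ σ z > σ x ∧ InB n (σ z)) ∨ (x < σ z ∧ σ z ≤ n)
      rw [inB_iff]
      rcases hz with hz | hz
      · have := h.neg_low x (-z)
        omega
      · have := h.neg_high x z
        omega
    have hinv : σ y ∈ S → y ∈ S := fun hm => SameCycle.mem_of_mapsTo hfin hmaps
      (Equiv.Perm.sameCycle_apply_left.2 (Equiv.Perm.SameCycle.refl _ _)) hm
    have hinv : ((1 ≤ -σ y ∧ σ y > σ x ∧ InB n (σ y)) ∨ (x < σ y ∧ σ y ≤ n)) →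
      ((1 ≤ -y ∧ y > σ x ∧ InB n y) ∨ (x < y ∧ y ≤ n)) := hinv
    rw [inB_iff, inB_iff] at hinv
    unfold bKey
    constructor <;> split_ifs <;> omega
  · have h1 := h.up x y
    have h2 := h.down x y
    unfold bKey
    constructor <;> split_ifs <;> omega

section

variable {n : ℕ} {σ τ : Equiv.Perm ℤ}

lemma ArcNC.up_symm (h : ArcNC n σ) {i x : ℤ} (h1 : 1 ≤ i) (h2 : i < x) (h3 : x < σ i) :
    i < σ.symm x ∧ σ.symm x < σ i :=
  Equiv.Perm.perm_symm_mapsTo_of_mapsTo (s := Set.Ioo i (σ i)) σ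
    (fun x hx => h.up i x h1 hx.1 hx.2) ⟨h2, h3⟩

lemma ArcNC.down_symm (h : ArcNC n σ) {i x : ℤ} (h1 : 0 < σ i) (h2 : σ i ≤ x) (h3 : x ≤ i) :
    σ i ≤ σ.symm x ∧ σ.symm x ≤ i :=
  Equiv.Perm.perm_symm_mapsTo_of_mapsTo (s := Set.Icc (σ i) i) σ
    (fun x hx => h.down i x h1 hx.1 hx.2) ⟨h2, h3⟩

lemma IsSignedPerm.symm (hσ : IsSignedPerm n σ) : IsSignedPerm n σ.symm := by
  refine ⟨fun x => ?_, fun x hx => ?_⟩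
  · rw [Equiv.symm_apply_eq, hσ.1, Equiv.apply_symm_apply]
  · rw [Equiv.symm_apply_eq, hσ.2 x hx]

lemma IsSignedPerm.bounds (hσ : IsSignedPerm n σ) {x : ℤ} (h1 : 1 ≤ x) (h2 : x ≤ n) :
    σ x ≠ 0 ∧ -(n : ℤ) ≤ σ x ∧ σ x ≤ n :=
  inB_iff.1 (hσ.inB_apply (inB_iff.2 (by omega)))

/-- The arc diagram on `1, …, 2n` associated with `σ`: `2i` is joined to `2 σ(i) - 1`. -/
def arcPartner (σ : Equiv.Perm ℤ) (p : ℤ) : ℤ :=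
  if p % 2 = 0 then 2 * σ (p / 2) - 1 else 2 * σ.symm ((p + 1) / 2)

lemma arcPartner_even (σ : Equiv.Perm ℤ) (i : ℤ) : arcPartner σ (2 * i) = 2 * σ i - 1 := by
  unfold arcPartner
  rw [if_pos (by omega), show 2 * i / 2 = i by omega]

lemma arcPartner_odd (σ : Equiv.Perm ℤ) (i : ℤ) :
    arcPartner σ (2 * i - 1) = 2 * σ.symm i := by
  unfold arcPartner
  rw [if_neg (by omega), show (2 * i - 1 + 1) / 2 = i by omega]

lemma even_or_odd_pred (p : ℤ) : ∃ i, p = 2 * i ∨ p = 2 * i - 1 :=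
  ⟨(p + 1) / 2, by omega⟩

lemma arcPartner_arcPartner (σ : Equiv.Perm ℤ) (p : ℤ) : arcPartner σ (arcPartner σ p) = p := by
  obtain ⟨i, rfl | rfl⟩ := even_or_odd_pred p
  · rw [arcPartner_even, arcPartner_odd, Equiv.symm_apply_apply]
  · rw [arcPartner_odd, arcPartner_even, Equiv.apply_symm_apply]

lemma arcPartner_ne (σ : Equiv.Perm ℤ) (p : ℤ) : arcPartner σ p ≠ p := by
  obtain ⟨i, rfl | rfl⟩ := even_or_odd_pred p
  · rw [arcPartner_even]; omega
  · rw [arcPartner_odd]; omega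

lemma IsSignedPerm.arcPartner_le (hσ : IsSignedPerm n σ) {p : ℤ} (h1 : 1 ≤ p) (h2 : p ≤ 2 * n) :
    arcPartner σ p ≤ 2 * n := by
  obtain ⟨i, rfl | rfl⟩ := even_or_odd_pred p
  · rw [arcPartner_even]
    have := hσ.bounds (x := i) (by omega) (by omega)
    omega
  · rw [arcPartner_odd]
    have := hσ.symm.bounds (x := i) (by omega) (by omega)
    omega

lemma ArcNC.arcPartner_nested (h : ArcNC n σ) {p q : ℤ} (h1 : 1 ≤ p) (h2 : p < q)
    (h3 : q < arcPartner σ p) : p < arcPartner σ q ∧ arcPartner σ q < arcPartner σ p := by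
  obtain ⟨i, rfl | rfl⟩ := even_or_odd_pred p
  · rw [arcPartner_even] at h3 ⊢
    obtain ⟨x, rfl | rfl⟩ := even_or_odd_pred q
    · rw [arcPartner_even]
      have := h.up i x
      omega
    · rw [arcPartner_odd]
      have := h.up_symm (i := i) (x := x)
      omega
  · rw [arcPartner_odd] at h3 ⊢
    obtain ⟨j, rfl⟩ := σ.surjective i
    rw [Equiv.symm_apply_apply] at h3 ⊢
    obtain ⟨x, rfl | rfl⟩ := even_or_odd_pred q
    · rw [arcPartner_even]
      have := h.down j x
      have : σ x ≠ σ j := fun e => by have := σ.injective e; omega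
      omega
    · rw [arcPartner_odd]
      have := h.down_symm (i := j) (x := x)
      have : σ.symm x ≠ j := fun e => by
        rw [Equiv.symm_apply_eq] at e
        omega
      omega

/-- The path of type `B_n` whose step number `2n + 1 - p` is north exactly when `p` is the larger
end of its arc. -/
noncomputable def ncPath (n : ℕ) (σ : Equiv.Perm ℤ) : Fin (2 * n) → Bool :=
  fun q => decide (arcPartner σ (2 * n - (q : ℕ)) < 2 * n - (q : ℕ))

lemma IsSignedPerm.isDyckB_ncPath (hσ : IsSignedPerm n σ) : IsDyckB n (ncPath n σ) := by
  intro k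
  unfold countE countN
  have hpos : ∀ q : Fin (2 * n), ncPath n σ q = false →
      (2 * n - (q : ℕ) : ℤ) < arcPartner σ (2 * n - (q : ℕ)) ∧
        arcPartner σ (2 * n - (q : ℕ)) ≤ 2 * n := by
    intro q hq
    have h1 := of_decide_eq_false hq
    have h2 := arcPartner_ne σ (2 * n - (q : ℕ))
    have h3 := hσ.arcPartner_le (p := 2 * n - (q : ℕ)) (by omega) (by omega)
    omega
  refine Finset.card_le_card_of_injOn (fun q =>
    if h : (2 * n - arcPartner σ (2 * n - (q : ℕ))).toNat < 2 * n then ⟨_, h⟩ else q) ?_ ?_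
  · intro q hq
    simp only [Finset.coe_filter, Finset.mem_univ, true_and, Set.mem_ofPred_eq] at hq ⊢
    have := hpos q hq.2
    rw [dif_pos (by omega)]
    refine ⟨by dsimp only; omega, ?_⟩
    unfold ncPath
    dsimp only
    rw [Int.toNat_of_nonneg (by omega), sub_sub_cancel, arcPartner_arcPartner]
    exact decide_eq_true this.1
  · intro q hq r hr hqr
    simp only [Finset.coe_filter, Finset.mem_univ, true_and, Set.mem_ofPred_eq] at hq hr
    have h1 := hpos q hq.2
    have h2 := hpos r hr.2
    dsimp only at hqr
    rw [dif_pos (by omega), dif_pos (by omega), Fin.mk.injEq] at hqr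
    have h3 : arcPartner σ (2 * n - (q : ℕ)) = arcPartner σ (2 * n - (r : ℕ)) := by omega
    have h4 := congrArg (arcPartner σ) h3
    rw [arcPartner_arcPartner, arcPartner_arcPartner] at h4
    exact Fin.ext (by omega)

lemma letterAt_ncPath {p : ℕ} (h1 : 1 ≤ p) (h2 : p ≤ 2 * n) :
    letterAt (ncPath n σ) (2 * n - p) = decide (arcPartner σ p < p) := by
  unfold letterAt ncPath
  rw [dif_pos (by omega)]
  dsimp only
  rw [show (2 * n - ((2 * n - p : ℕ) : ℤ)) = p by omega]

lemma letterAt_ncPath_even {i : ℕ} (h1 : 1 ≤ i) (h2 : i ≤ n) :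
    letterAt (ncPath n σ) (2 * n - 2 * i) = true ↔ σ i ≤ i := by
  rw [letterAt_ncPath (by omega) (by omega), decide_eq_true_iff]
  push_cast
  rw [arcPartner_even]
  omega

lemma letterAt_ncPath_odd {i : ℕ} (h1 : 1 ≤ i) (h2 : i ≤ n) :
    letterAt (ncPath n σ) (2 * n - (2 * i - 1)) = true ↔ σ.symm i < i := by
  rw [letterAt_ncPath (by omega) (by omega), decide_eq_true_iff]
  push_cast [show 1 ≤ 2 * i by omega]
  rw [arcPartner_odd]
  omega

lemma sum_range_two_mul (F : ℕ → ℕ) (n : ℕ) :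
    ∑ q ∈ Finset.range (2 * n), F q = ∑ i ∈ Finset.range n, (F (2 * i) + F (2 * i + 1)) := by
  induction n with
  | zero => simp
  | succ n ih =>
    rw [show 2 * (n + 1) = 2 * n + 1 + 1 by ring, Finset.sum_range_succ, Finset.sum_range_succ, ih,
      Finset.sum_range_succ]
    ring

lemma ArcNC.peakSum_ncPath (h : ArcNC n σ) :
    peakSum (ncPath n σ) = ∑ i ∈ Finset.range n,
      ((if σ i = i + 1 then 2 * i else 0) + if σ (i + 1) = i + 1 then 2 * i + 1 else 0) := by
  unfold peakSum
  rw [← Finset.sum_range_reflect, sum_range_two_mul]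
  refine Finset.sum_congr rfl fun i hi => ?_
  rw [Finset.mem_range] at hi
  congr 1
  · rcases Nat.eq_zero_or_pos i with rfl | hi0
    · split_ifs <;> omega
    · have e1 := letterAt_ncPath_odd (σ := σ) (i := i + 1) (by omega) hi
      have e2 := letterAt_ncPath_even (σ := σ) (i := i) hi0 hi.le
      rw [show 2 * n - 1 - 2 * i = 2 * n - (2 * (i + 1) - 1) by omega,
        show 2 * n - (2 * (i + 1) - 1) + 1 = 2 * n - 2 * i by omega,
        show 2 * n - 1 - (2 * n - (2 * (i + 1) - 1)) = 2 * i by omega]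
      refine if_congr ?_ rfl rfl
      rw [e1, ← Bool.not_eq_true, e2]
      push_cast
      constructor
      · rintro ⟨h1, h2⟩
        by_contra h3
        have := h.up_symm (i := i) (x := i + 1) (by omega) (by omega) (by omega)
        omega
      · intro h1
        have : σ.symm (i + 1) = i := by rw [Equiv.symm_apply_eq, h1]
        omega
  · have e1 := letterAt_ncPath_odd (σ := σ) (i := i + 1) (by omega) hi
    have e2 := letterAt_ncPath_even (σ := σ) (i := i + 1) (by omega) hi
    rw [show 2 * n - 1 - (2 * i + 1) = 2 * n - 2 * (i + 1) by omega,
      show 2 * n - 2 * (i + 1) + 1 = 2 * n - (2 * (i + 1) - 1) by omega,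
      show 2 * n - 1 - (2 * n - 2 * (i + 1)) = 2 * i + 1 by omega]
    refine if_congr ?_ rfl rfl
    rw [e2, ← Bool.not_eq_true, e1]
    push_cast
    obtain ⟨j, hj⟩ := σ.surjective (i + 1)
    have hj' : σ.symm (i + 1) = j := by rw [Equiv.symm_apply_eq, hj]
    rw [hj']
    constructor
    · rintro ⟨h1, h2⟩
      have := h.down j (i + 1)
      omega
    · intro h1
      have := σ.injective (h1.trans hj.symm)
      omega

lemma arcPartner_eq_of_opener (hσ : ArcNC n σ) (hτ : ArcNC n τ)
    (hl : ∀ p : ℤ, 1 ≤ p → p ≤ 2 * n → (arcPartner σ p < p ↔ arcPartner τ p < p)) (d : ℕ) :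
    ∀ p : ℤ, 1 ≤ p → p < arcPartner σ p → arcPartner σ p ≤ 2 * n → arcPartner σ p - p = d →
      arcPartner τ p = arcPartner σ p := by
  induction d using Nat.strong_induction_on generalizing σ τ with
  | _ d ih =>
    intro p h1 h2 h3 h4
    have hl' : ∀ p : ℤ, 1 ≤ p → p ≤ 2 * n → (arcPartner τ p < p ↔ arcPartner σ p < p) :=
      fun p h h' => (hl p h h').symm
    have ho : p < arcPartner τ p := by
      have := hl p h1 (by omega)
      have := arcPartner_ne τ p
      omega
    rcases lt_trichotomy (arcPartner τ p) (arcPartner σ p) with hr | hr | hr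
    · exact (ih (arcPartner τ p - p).toNat (by omega) hτ hσ hl' p h1 ho (by omega)
        (by omega)).symm
    · exact hr
    · have hq := hτ.arcPartner_nested h1 h2 hr
      have hc : arcPartner τ (arcPartner σ p) < arcPartner σ p :=
        (hl _ (by omega) h3).1 (by rw [arcPartner_arcPartner]; exact h2)
      have hp := arcPartner_arcPartner σ p
      generalize arcPartner σ p = q at *
      have := ih (q - arcPartner τ q).toNat (by omega) hτ hσ hl' (arcPartner τ q) (by omega)
        (by rw [arcPartner_arcPartner]; omega) (by rw [arcPartner_arcPartner]; omega)
        (by rw [arcPartner_arcPartner]; omega)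
      rw [arcPartner_arcPartner] at this
      have h5 := congrArg (arcPartner σ) this
      rw [arcPartner_arcPartner, hp] at h5
      omega

lemma arcPartner_eq (hσ : ArcNC n σ) (hτ : ArcNC n τ)
    (hl : ∀ p : ℤ, 1 ≤ p → p ≤ 2 * n → (arcPartner σ p < p ↔ arcPartner τ p < p))
    {p : ℤ} (h1 : 1 ≤ p) (h2 : p ≤ 2 * n) (h3 : 1 ≤ arcPartner σ p) :
    arcPartner τ p = arcPartner σ p := by
  have h4 := hσ.signed.arcPartner_le h1 h2
  rcases lt_or_gt_of_ne (arcPartner_ne σ p) with h | h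
  · have := arcPartner_eq_of_opener hσ hτ hl (p - arcPartner σ p).toNat (arcPartner σ p) h3
      (by rwa [arcPartner_arcPartner]) (by rwa [arcPartner_arcPartner])
      (by rw [arcPartner_arcPartner]; omega)
    rw [arcPartner_arcPartner] at this
    rw [← congrArg (arcPartner τ) this, arcPartner_arcPartner]
  · exact arcPartner_eq_of_opener hσ hτ hl (arcPartner σ p - p).toNat p h1 h h4 (by omega)

lemma ArcNC.lt_of_neg (h : ArcNC n σ) {i x : ℤ} (h1 : 1 ≤ i) (h2 : i < x) (h3 : x ≤ n)
    (hi : σ i < 0) (hx : σ x < 0) : σ i < σ x := by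
  have := h.neg_high i x h1 hi h2 h3
  omega

lemma not_apply_lt_of_neg (hσ : ArcNC n σ) (hτ : ArcNC n τ)
    (hpos : ∀ i : ℤ, 1 ≤ i → i ≤ n → (0 < σ i ∨ 0 < τ i) → σ i = τ i) {i : ℤ} (h1 : 1 ≤ i)
    (h2 : i ≤ n) (hi : σ i < 0) (hlt : ∀ k, 1 ≤ k → k < i → σ k < 0 → σ k = τ k) :
    ¬ σ i < τ i := by
  intro h
  obtain ⟨k, hk⟩ := τ.surjective (σ i)
  have hB : InB n k := by
    rw [show k = τ.symm (σ i) by rw [← hk, Equiv.symm_apply_apply]]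
    exact hτ.signed.symm.inB_apply (hσ.signed.inB_apply (inB_iff.2 (by omega)))
  rw [inB_iff] at hB
  rcases lt_or_gt_of_ne hB.1 with hk0 | hk0
  · have h3 := hτ.signed.1 k
    have h4 := hpos (-k) (by omega) (by omega) (by omega)
    have h5 := hσ.signed.1 i
    have := σ.injective (h4.trans (h3.trans ((congrArg (- ·) hk).trans h5.symm)))
    omega
  · have h3 := hpos i h1 h2
    have h4 : σ k < 0 := by
      have := hpos k (by omega) hB.2.2
      have := hσ.signed.bounds (x := k) (by omega) hB.2.2
      omega
    have h5 := hτ.signed.bounds h1 h2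
    rcases lt_trichotomy k i with h6 | h6 | h6
    · have := σ.injective ((hlt k hk0 h6 h4).trans hk)
      omega
    · rw [h6] at hk
      omega
    · have := hτ.lt_of_neg h1 h6 hB.2.2 (by omega) (by omega)
      omega

lemma apply_eq_of_neg (hσ : ArcNC n σ) (hτ : ArcNC n τ)
    (hpos : ∀ i : ℤ, 1 ≤ i → i ≤ n → (0 < σ i ∨ 0 < τ i) → σ i = τ i) (m : ℕ) :
    ∀ i : ℤ, i = m → 1 ≤ i → i ≤ n → σ i < 0 → σ i = τ i := by
  have hneg : ∀ i : ℤ, 1 ≤ i → i ≤ n → (σ i < 0 ↔ τ i < 0) := by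
    intro i h1 h2
    have := hpos i h1 h2
    have := hτ.signed.bounds h1 h2
    have := hσ.signed.bounds h1 h2
    omega
  induction m using Nat.strong_induction_on with
  | _ m ih =>
    intro i hi h1 h2 h3
    have hlt : ∀ k, 1 ≤ k → k < i → σ k < 0 → σ k = τ k :=
      fun k hk hk' hk'' => ih k.toNat (by omega) k (by omega) hk (by omega) hk''
    have := not_apply_lt_of_neg hσ hτ hpos h1 h2 h3 hlt
    have := not_apply_lt_of_neg hτ hσ (fun i a b c => (hpos i a b c.symm).symm) h1 h2
      ((hneg i h1 h2).1 h3)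
      (fun k a b c => (hlt k a b ((hneg k a (by omega)).2 c)).symm)
    omega

lemma ncPath_injOn (hσ : ArcNC n σ) (hτ : ArcNC n τ) (h : ncPath n σ = ncPath n τ) : σ = τ := by
  have hl : ∀ p : ℤ, 1 ≤ p → p ≤ 2 * n → (arcPartner σ p < p ↔ arcPartner τ p < p) := by
    intro p h1 h2
    lift p to ℕ using by omega
    have : letterAt (ncPath n σ) (2 * n - p) = letterAt (ncPath n τ) (2 * n - p) := by rw [h]
    rwa [letterAt_ncPath (by omega) (by omega), letterAt_ncPath (by omega) (by omega),
      decide_eq_decide] at this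
  have hl' : ∀ p : ℤ, 1 ≤ p → p ≤ 2 * n → (arcPartner τ p < p ↔ arcPartner σ p < p) :=
    fun p h h' => (hl p h h').symm
  have hpos : ∀ i : ℤ, 1 ≤ i → i ≤ n → (0 < σ i ∨ 0 < τ i) → σ i = τ i := by
    rintro i h1 h2 (h3 | h3)
    · have := arcPartner_eq hσ hτ hl (p := 2 * i) (by omega) (by omega)
        (by rw [arcPartner_even]; omega)
      rw [arcPartner_even, arcPartner_even] at this
      omega
    · have := arcPartner_eq hτ hσ hl' (p := 2 * i) (by omega) (by omega)
        (by rw [arcPartner_even]; omega)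
      rw [arcPartner_even, arcPartner_even] at this
      omega
  have hall : ∀ i : ℤ, 1 ≤ i → σ i = τ i := by
    intro i h1
    by_cases h2 : i ≤ n
    · rcases lt_or_ge (σ i) 0 with h3 | h3
      · exact apply_eq_of_neg hσ hτ hpos i.toNat i (by omega) h1 h2 h3
      · have := hσ.signed.bounds h1 h2
        exact hpos i h1 h2 (by omega)
    · rw [hσ.signed.apply_eq_self (by omega), hτ.signed.apply_eq_self (by omega)]
  ext x
  rcases lt_trichotomy x 0 with hx | rfl | hx
  · have := hall (-x) (by omega)
    rw [hσ.signed.1, hτ.signed.1] at this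
    omega
  · rw [hσ.signed.2 0 (by simp), hτ.signed.2 0 (by simp)]
  · exact hall x hx

end

lemma exists_revW_eq {n : ℕ} (f : Fin n → ℤ) : ∃ r : Fin n → Fin n,
    (∀ i, f i < 0 → f (r i) < 0 ∧ revW f i = f (r i) ∧ r (r i) = i) ∧
      ∀ i j, f i < 0 → f j < 0 → i < j → r j < r i := by
  set s := Finset.univ.filter (fun t : Fin n => f t < 0) with hs
  set m := s.card with hm
  set e := s.orderIsoOfFin hm.symm with he
  have hmem : ∀ a, f (e a) < 0 := fun a =>
    (Finset.mem_filter.1 (e a).2).2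
  have hsurj : ∀ i, f i < 0 → ∃ a, (e a : Fin n) = i := fun i hi =>
    ⟨e.symm ⟨i, by rw [hs, Finset.mem_filter]; exact ⟨Finset.mem_univ _, hi⟩⟩, by simp⟩
  have hlt : ∀ a b, (e a : Fin n) < e b ↔ a < b := fun a b => by
    rw [Subtype.coe_lt_coe, e.lt_iff_lt]
  have hle : ∀ a b, (e a : Fin n) ≤ e b ↔ a ≤ b := fun a b => by
    rw [Subtype.coe_le_coe, e.le_iff_le]
  have hdown : ∀ a, (Finset.univ.filter fun t : Fin n => f t < 0 ∧ t ≤ e a).card = a + 1 := by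
    intro a
    rw [← Fin.card_Iic, ← Finset.card_map (e.toEquiv.toEmbedding.trans (Function.Embedding.subtype _))]
    congr 1
    ext t
    simp only [Finset.mem_filter, Finset.mem_univ, true_and, Finset.mem_map, Finset.mem_Iic]
    constructor
    · rintro ⟨h1, h2⟩
      obtain ⟨b, rfl⟩ := hsurj t h1
      exact ⟨b, (hle b a).1 h2, rfl⟩
    · rintro ⟨b, hb, rfl⟩
      exact ⟨hmem b, (hle b a).2 hb⟩
  have hup : ∀ a, (Finset.univ.filter fun t : Fin n => f t < 0 ∧ e a ≤ t).card = m - a := by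
    intro a
    rw [← Fin.card_Ici, ← Finset.card_map (e.toEquiv.toEmbedding.trans (Function.Embedding.subtype _))]
    congr 1
    ext t
    simp only [Finset.mem_filter, Finset.mem_univ, true_and, Finset.mem_map, Finset.mem_Ici]
    constructor
    · rintro ⟨h1, h2⟩
      obtain ⟨b, rfl⟩ := hsurj t h1
      exact ⟨b, (hle a b).1 h2, rfl⟩
    · rintro ⟨b, hb, rfl⟩
      exact ⟨hmem b, (hle a b).2 hb⟩
  obtain ⟨r, hr⟩ : ∃ r : Fin n → Fin n, ∀ a, r (e a) = e a.rev := by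
    refine ⟨fun i => if hi : f i < 0 then e (e.symm ⟨i, by simpa [hs] using hi⟩).rev else i,
      fun a => ?_⟩
    simp [hmem a]
  refine ⟨r, fun i hi => ?_, fun i j hi hj hij => ?_⟩
  · obtain ⟨a, rfl⟩ := hsurj i hi
    rw [hr, hr, Fin.rev_rev]
    refine ⟨hmem _, ?_, rfl⟩
    unfold revW
    rw [if_neg (by omega), Finset.sum_eq_single (e a.rev : Fin n)]
    · rw [if_pos ⟨hmem _, by rw [hdown, hup, Fin.val_rev]; omega⟩]
    · intro j _ hj
      refine if_neg fun ⟨h1, h2⟩ => hj ?_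
      obtain ⟨b, rfl⟩ := hsurj j h1
      rw [hdown, hup] at h2
      congr 2
      rw [Fin.ext_iff, Fin.val_rev]
      omega
    · simp
  · obtain ⟨a, rfl⟩ := hsurj i hi
    obtain ⟨b, rfl⟩ := hsurj j hj
    rw [hlt] at hij
    rw [hr, hr, hlt]
    exact Fin.rev_lt_rev.2 hij

lemma majW_eq_sum {n : ℕ} {f : Fin n → ℤ} {W : ℕ → ℤ} (hW : ∀ i : Fin n, f i = W (i + 1)) :
    (majW f : ℤ) = ∑ m ∈ Finset.range n, m * if W (m + 1) < W m then 1 else 0 := by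
  unfold majW
  rcases n with _ | n
  · simp
  rw [Finset.sum_range_succ', Finset.sum_filter, Fin.sum_univ_castSucc,
    ← Fin.sum_univ_eq_sum_range]
  have hlast : ¬ ∃ h : ((Fin.last n : Fin (n + 1)) : ℕ) + 1 < n + 1,
      f ⟨(Fin.last n : ℕ) + 1, h⟩ < f (Fin.last n) := by
    rintro ⟨h, -⟩
    simp at h
  rw [if_neg hlast]
  push_cast
  simp only [add_zero, zero_mul]
  refine Finset.sum_congr rfl fun i _ => ?_
  have h1 : ∃ h : ((i.castSucc : Fin (n + 1)) : ℕ) + 1 < n + 1, True := ⟨by simp, trivial⟩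
  have h2 : (∃ h : ((i.castSucc : Fin (n + 1)) : ℕ) + 1 < n + 1,
      f ⟨(i.castSucc : ℕ) + 1, h⟩ < f i.castSucc) ↔ W (i + 1 + 1) < W (i + 1) := by
    constructor
    · rintro ⟨h, h'⟩
      rwa [hW, hW] at h'
    · intro h
      refine ⟨by simp, ?_⟩
      rwa [hW, hW]
  simp only [h2]
  split_ifs <;> simp

/-- Summation by parts for descent indicators of the shape occurring for non-crossing words. -/
lemma sum_mul_sub_indicator (U Z A : ℕ → ℤ) (n : ℕ) (hU : U n = 0) :
    ∑ m ∈ Finset.range n, (m : ℤ) * (1 - Z (m + 1) - U (m + 1) + U m - A m) =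
      ∑ m ∈ Finset.range n, (m - m * Z (m + 1) - m * A m + U (m + 1)) := by
  have key : ∀ k : ℕ, ∑ m ∈ Finset.range k, (m : ℤ) * (1 - Z (m + 1) - U (m + 1) + U m - A m) +
      k * U k =
      ∑ m ∈ Finset.range k, (m - m * Z (m + 1) - m * A m + U (m + 1)) := by
    intro k
    induction k with
    | zero => simp
    | succ k ih =>
      rw [Finset.sum_range_succ, Finset.sum_range_succ, ← ih]
      push_cast
      ring
  rw [← key, hU]
  simp

section

variable {n : ℕ} {σ : Equiv.Perm ℤ}

/-- The entries of `revW (word n σ)`. -/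
lemma ArcNC.revW_word (h : ArcNC n σ) : ∃ W : ℕ → ℤ,
    (∀ i : Fin n, revW (word n σ) i = W (i + 1)) ∧
    (∀ m : ℕ, 1 ≤ m → m ≤ n → 0 < σ m → W m = σ m) ∧
    (∀ m : ℕ, 1 ≤ m → m ≤ n → σ m < 0 → W m < 0) ∧
    ∀ m : ℕ, 1 ≤ m → m + 1 ≤ n → σ m < 0 → σ (m + 1) < 0 → W (m + 1) < W m := by
  obtain ⟨r, hr, hr'⟩ := exists_revW_eq (word n σ)
  refine ⟨fun m => if hm : m - 1 < n then revW (word n σ) ⟨m - 1, hm⟩ else 0,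
    fun i => ?_, fun m h1 h2 h3 => ?_, fun m h1 h2 h3 => ?_, fun m h1 h2 h3 h4 => ?_⟩
  · simp
  · have e : word n σ ⟨m - 1, by omega⟩ = σ m := by
      unfold word
      congr 1
      push_cast [h1]
      ring
    dsimp only
    rw [dif_pos (by omega), ← e, revW, if_pos (by omega)]
  · have e : word n σ ⟨m - 1, by omega⟩ = σ m := by
      unfold word
      congr 1
      push_cast [h1]
      ring
    dsimp only
    rw [dif_pos (by omega)]
    have := hr ⟨m - 1, by omega⟩ (by omega)
    omega
  · have e : word n σ ⟨m - 1, by omega⟩ = σ m := by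
      unfold word
      congr 1
      push_cast [h1]
      ring
    have e' : word n σ ⟨m + 1 - 1, by omega⟩ = σ (m + 1) := rfl
    dsimp only
    rw [dif_pos (by omega), dif_pos (by omega)]
    have a1 := hr ⟨m - 1, by omega⟩ (by omega)
    have a2 := hr ⟨m + 1 - 1, by omega⟩ (by omega)
    have a3 : r ⟨m + 1 - 1, by omega⟩ < r ⟨m - 1, by omega⟩ :=
      hr' _ _ (by omega) (by omega) (by rw [Fin.mk_lt_mk]; omega)
    rw [a1.2.1, a2.2.1]
    have l := Fin.lt_def.1 a3
    exact h.lt_of_neg (by omega) (by omega) (by omega) a2.1 a1.1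

/-- The entries of `wInv (revW (word n σ))`. -/
lemma ArcNC.wInv_revW_word (h : ArcNC n σ) : ∃ W : ℕ → ℤ,
    (∀ i : Fin n, wInv (revW (word n σ)) i = W (i + 1)) ∧
    (∀ m : ℕ, 1 ≤ m → m ≤ n → 0 < σ.symm m → W m = σ.symm m) ∧
    (∀ m : ℕ, 1 ≤ m → m ≤ n → σ.symm m < 0 → W m < 0) ∧
    ∀ m : ℕ, 1 ≤ m → m + 1 ≤ n → σ.symm m < 0 → σ.symm (m + 1) < 0 → W (m + 1) < W m := by
  obtain ⟨r, hr, hr'⟩ := exists_revW_eq (word n σ)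
  have hinj : ∀ i j : Fin n, word n σ i = word n σ j → i = j := by
    intro i j hij
    have := σ.injective hij
    exact Fin.ext (by omega)
  have hf : ∀ i : Fin n, 0 < word n σ i → revW (word n σ) i = word n σ i := by
    intro i hi
    rw [revW, if_pos (by omega)]
  have h0 : ∀ i : Fin n, word n σ i ≠ 0 := fun i => h.signed.apply_ne_zero (by omega)
  have hpos : ∀ i j : Fin n, word n σ i = j + 1 → wInv (revW (word n σ)) j = i + 1 := by
    intro i j hij
    rw [wInv, Finset.sum_eq_single i]
    · rw [hf i (by omega), if_pos hij]
    · intro b _ hb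
      rw [if_neg, if_neg]
      · intro e
        have : word n σ b < 0 := by
          by_contra h1
          rw [hf b (by have := h0 b; omega)] at e
          omega
        rw [(hr b this).2.1] at e
        have h2 := h.signed.1 ((i : ℤ) + 1)
        have h3 : σ (-((i : ℤ) + 1)) = σ ((r b : ℕ) + 1) := by
          rw [h2]
          unfold word at e hij
          rw [e, hij]
        have := σ.injective h3
        omega
      · intro e
        have : 0 < word n σ b := by
          by_contra h1
          have := hr b (by have := h0 b; omega)
          omega
        rw [hf b this] at e
        exact hb (hinj _ _ (e.trans hij.symm))
    · simp
  have hneg : ∀ i j : Fin n, word n σ i = -((j : ℤ) + 1) →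
      wInv (revW (word n σ)) j = -((r i : ℕ) + 1) := by
    intro i j hij
    have hi : word n σ i < 0 := by omega
    have hri := hr i hi
    have hrr := hr (r i) hri.1
    rw [wInv, Finset.sum_eq_single (r i)]
    · rw [hrr.2.1, hri.2.2, hij, if_neg (by omega), if_pos rfl]
    · intro b _ hb
      rw [if_neg, if_neg]
      · intro e
        have : word n σ b < 0 := by
          by_contra h1
          rw [hf b (by have := h0 b; omega)] at e
          omega
        have hb' := hr b this
        rw [hb'.2.1] at e
        apply hb
        rw [← hinj _ _ (e.trans hij.symm), hb'.2.2]
      · intro e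
        have : 0 < word n σ b := by
          by_contra h1
          have := hr b (by have := h0 b; omega)
          omega
        rw [hf b this] at e
        have h2 := h.signed.1 ((i : ℤ) + 1)
        have h3 : σ (-((i : ℤ) + 1)) = σ ((b : ℕ) + 1) := by
          rw [h2]
          unfold word at e hij
          rw [e, hij]
          ring
        have := σ.injective h3
        omega
    · simp
  have hex : ∀ m : ℕ, 1 ≤ m → m ≤ n → σ.symm m < 0 →
      ∃ i : Fin n, word n σ i = -m ∧ σ.symm m = -(i + 1) := by
    intro m h1 h2 h3
    have := h.signed.symm.bounds (x := m) (by omega) (by omega)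
    refine ⟨⟨(-σ.symm m - 1).toNat, by omega⟩, ?_, ?_⟩
    · unfold word
      dsimp only
      rw [Int.toNat_of_nonneg (by omega), sub_add_cancel, h.signed.1, Equiv.apply_symm_apply]
    · dsimp only
      omega
  refine ⟨fun m => if hm : m - 1 < n then wInv (revW (word n σ)) ⟨m - 1, hm⟩ else 0,
    fun i => ?_, fun m h1 h2 h3 => ?_, fun m h1 h2 h3 => ?_, fun m h1 h2 h3 h4 => ?_⟩
  · simp
  · have := h.signed.symm.bounds (x := m) (by omega) (by omega)
    dsimp only
    rw [dif_pos (by omega), hpos ⟨(σ.symm m - 1).toNat, by omega⟩]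
    · dsimp only
      omega
    · unfold word
      dsimp only
      rw [Int.toNat_of_nonneg (by omega), sub_add_cancel, Equiv.apply_symm_apply]
      omega
  · obtain ⟨i, hi, -⟩ := hex m h1 h2 h3
    dsimp only
    rw [dif_pos (by omega), hneg i _ (by rw [hi]; dsimp only; omega)]
    omega
  · obtain ⟨i, hi, hi'⟩ := hex m h1 (by omega) h3
    obtain ⟨j, hj, hj'⟩ := hex (m + 1) (by omega) (by omega) (by exact_mod_cast h4)
    dsimp only
    rw [dif_pos (by omega), dif_pos (by omega),
      hneg i ⟨m - 1, by omega⟩ (by rw [hi]; dsimp only; omega),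
      hneg j ⟨m + 1 - 1, by omega⟩ (by rw [hj]; dsimp only; omega)]
    have hji : j < i := by
      by_contra! hle
      rcases lt_or_eq_of_le hle with h5 | h5
      · have := h.lt_of_neg (i := i + 1) (x := j + 1) (by omega) (by have := Fin.lt_def.1 h5; omega)
          (by omega) (by unfold word at hi; omega) (by unfold word at hj; omega)
        unfold word at hi hj
        omega
      · subst h5
        omega
    have := Fin.lt_def.1 (hr' j i (by omega) (by omega) hji)
    omega

lemma ArcNC.descent_word (h : ArcNC n σ) {W : ℕ → ℤ}
    (h1 : ∀ m : ℕ, 1 ≤ m → m ≤ n → 0 < σ m → W m = σ m)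
    (h2 : ∀ m : ℕ, 1 ≤ m → m ≤ n → σ m < 0 → W m < 0)
    (h3 : ∀ m : ℕ, 1 ≤ m → m + 1 ≤ n → σ m < 0 → σ (m + 1) < 0 → W (m + 1) < W m)
    {m : ℕ} (hm : 1 ≤ m) (hm' : m < n) :
    (if W (m + 1) < W m then 1 else 0 : ℤ) =
      1 - (if σ (m + 1) = m + 1 then 1 else 0) - (if σ (m + 1) > m + 1 then 1 else 0) +
        (if σ m > m then 1 else 0) - if σ m = m + 1 then 1 else 0 := by
  have a1 := h1 m hm hm'.le
  have a2 := h1 (m + 1) (by omega) hm'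
  have b1 := h2 m hm hm'.le
  have b2 := h2 (m + 1) (by omega) hm'
  have c := h3 m hm hm'
  push_cast at a2 b2
  have z1 := h.signed.bounds (x := m) (by omega) (by omega)
  have z2 := h.signed.bounds (x := m + 1) (by omega) (by omega)
  have d1 := h.up m (m + 1)
  have d2 := h.down (m + 1) m
  have d3 : σ m ≠ σ (m + 1) := fun e => by have := σ.injective e; omega
  generalize σ (m : ℤ) = a at *
  generalize σ ((m : ℤ) + 1) = b at *
  generalize W m = c1 at *
  generalize W (m + 1) = c2 at *
  split_ifs <;> omega

lemma ArcNC.descent_inv (h : ArcNC n σ) {W : ℕ → ℤ}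
    (h1 : ∀ m : ℕ, 1 ≤ m → m ≤ n → 0 < σ.symm m → W m = σ.symm m)
    (h2 : ∀ m : ℕ, 1 ≤ m → m ≤ n → σ.symm m < 0 → W m < 0)
    (h3 : ∀ m : ℕ, 1 ≤ m → m + 1 ≤ n → σ.symm m < 0 → σ.symm (m + 1) < 0 → W (m + 1) < W m)
    {m : ℕ} (hm : 1 ≤ m) (hm' : m < n) :
    (if W (m + 1) < W m then 1 else 0 : ℤ) =
      1 - (if σ (m + 1) = m + 1 then 1 else 0) - (if σ.symm (m + 1) > m + 1 then 1 else 0) +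
        (if σ.symm m > m then 1 else 0) - if σ m = m + 1 then 1 else 0 := by
  have a1 := h1 m hm hm'.le
  have a2 := h1 (m + 1) (by omega) hm'
  have b1 := h2 m hm hm'.le
  have b2 := h2 (m + 1) (by omega) hm'
  have c := h3 m hm hm'
  push_cast at a2 b2
  have z1 := h.signed.symm.bounds (x := m) (by omega) (by omega)
  have z2 := h.signed.symm.bounds (x := m + 1) (by omega) (by omega)
  have d1 := h.down_symm (i := σ.symm m) (x := m + 1)
  have d2 := h.up_symm (i := σ.symm (m + 1)) (x := m)
  rw [Equiv.apply_symm_apply] at d1 d2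
  have d3 : σ.symm m ≠ σ.symm (m + 1) := fun e => by have := σ.symm.injective e; omega
  have e1 : (σ (m + 1) = m + 1) ↔ σ.symm (m + 1) = m + 1 := by
    rw [Equiv.symm_apply_eq, eq_comm]
  have e2 : (σ m = m + 1) ↔ σ.symm (m + 1) = m := by rw [Equiv.symm_apply_eq, eq_comm]
  simp only [e1, e2]
  clear e1 e2
  generalize σ.symm (m : ℤ) = a at *
  generalize σ.symm ((m : ℤ) + 1) = b at *
  generalize W m = c1 at *
  generalize W (m + 1) = c2 at *
  split_ifs <;> omega

end

section

variable {n : ℕ} {σ : Equiv.Perm ℤ}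

lemma IsSignedPerm.card_symm_gt (h : IsSignedPerm n σ) :
    ((Finset.range n).filter fun m : ℕ => σ.symm (m + 1) > m + 1).card =
      ((Finset.range n).filter fun m : ℕ => 0 < σ (m + 1) ∧ σ (m + 1) < m + 1).card := by
  refine Finset.card_nbij' (fun m => (σ.symm (m + 1) - 1).toNat)
    (fun m => (σ (m + 1) - 1).toNat) ?_ ?_ ?_ ?_
  all_goals
    intro m hm
    rw [Finset.mem_coe, Finset.mem_filter, Finset.mem_range] at hm
    have z1 := h.bounds (x := m + 1) (by omega) (by omega)
    have z2 := h.symm.bounds (x := m + 1) (by omega) (by omega)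
  · rw [Finset.mem_coe, Finset.mem_filter, Finset.mem_range]
    dsimp only
    rw [Int.toNat_of_nonneg (by omega),
      sub_add_cancel, Equiv.apply_symm_apply]
    omega
  · rw [Finset.mem_coe, Finset.mem_filter, Finset.mem_range]
    dsimp only
    rw [Int.toNat_of_nonneg (by omega),
      sub_add_cancel, Equiv.symm_apply_apply]
    omega
  · dsimp only
    rw [Int.toNat_of_nonneg (by omega), sub_add_cancel, Equiv.apply_symm_apply]
    omega
  · dsimp only
    rw [Int.toNat_of_nonneg (by omega), sub_add_cancel, Equiv.symm_apply_apply]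
    omega

lemma IsSignedPerm.card_symm_neg (h : IsSignedPerm n σ) :
    ((Finset.range n).filter fun m : ℕ => σ.symm (m + 1) < 0).card =
      ((Finset.range n).filter fun m : ℕ => σ (m + 1) < 0).card := by
  refine Finset.card_nbij' (fun m => (-σ.symm (m + 1) - 1).toNat)
    (fun m => (-σ (m + 1) - 1).toNat) ?_ ?_ ?_ ?_
  all_goals
    intro m hm
    rw [Finset.mem_coe, Finset.mem_filter, Finset.mem_range] at hm
    have z1 := h.bounds (x := m + 1) (by omega) (by omega)
    have z2 := h.symm.bounds (x := m + 1) (by omega) (by omega)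
  · rw [Finset.mem_coe, Finset.mem_filter, Finset.mem_range]
    dsimp only
    rw [Int.toNat_of_nonneg (by omega),
      sub_add_cancel, h.1, Equiv.apply_symm_apply]
    omega
  · rw [Finset.mem_coe, Finset.mem_filter, Finset.mem_range]
    dsimp only
    rw [Int.toNat_of_nonneg (by omega),
      sub_add_cancel, h.symm.1, Equiv.symm_apply_apply]
    omega
  · dsimp only
    rw [Int.toNat_of_nonneg (by omega), sub_add_cancel, h.1, Equiv.apply_symm_apply]
    omega
  · dsimp only
    rw [Int.toNat_of_nonneg (by omega), sub_add_cancel, h.symm.1, Equiv.symm_apply_apply]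
    omega

lemma card_negSetW {f : Fin n → ℤ} {τ : Equiv.Perm ℤ} (hτ : IsSignedPerm n τ) {W : ℕ → ℤ}
    (hW : ∀ i : Fin n, f i = W (i + 1))
    (h1 : ∀ m : ℕ, 1 ≤ m → m ≤ n → 0 < τ m → W m = τ m)
    (h2 : ∀ m : ℕ, 1 ≤ m → m ≤ n → τ m < 0 → W m < 0) :
    (negSetW f).card = ((Finset.range n).filter fun m : ℕ => τ (m + 1) < 0).card := by
  unfold negSetW
  rw [Finset.card_filter, Finset.card_filter, ← Fin.sum_univ_eq_sum_range]
  refine Finset.sum_congr rfl fun i _ => if_congr ?_ rfl rfl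
  have a1 := h1 (i + 1) (by omega) (by omega)
  have a2 := h2 (i + 1) (by omega) (by omega)
  have a3 := hτ.bounds (x := i + 1) (by omega) (by omega)
  push_cast at a1 a2
  rw [hW]
  omega

lemma majW_of_descents {f : Fin n → ℤ} {W U Z A : ℕ → ℤ} (hW : ∀ i : Fin n, f i = W (i + 1))
    (hU : U n = 0) (hdes : ∀ m, 1 ≤ m → m < n →
      (if W (m + 1) < W m then 1 else 0) = 1 - Z (m + 1) - U (m + 1) + U m - A m) :
    (majW f : ℤ) = ∑ m ∈ Finset.range n, ((m : ℤ) - m * Z (m + 1) - m * A m + U (m + 1)) := by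
  rw [majW_eq_sum hW, ← sum_mul_sub_indicator U Z A n hU]
  push_cast
  refine Finset.sum_congr rfl fun m hm => ?_
  rcases Nat.eq_zero_or_pos m with rfl | h0
  · simp
  · rw [hdes m h0 (Finset.mem_range.1 hm)]

lemma sum_count (h : IsSignedPerm n σ) :
    ∑ m ∈ Finset.range n, ((if σ (m + 1) > m + 1 then 1 else 0 : ℤ) +
      (if σ.symm (m + 1) > m + 1 then 1 else 0) + (if σ (m + 1) = m + 1 then 1 else 0)) +
      (((Finset.range n).filter fun m : ℕ => σ (m + 1) < 0).card : ℤ) = n := by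
  have e := h.card_symm_gt
  rw [Finset.card_filter, Finset.card_filter] at e
  rw [Finset.card_filter, Finset.sum_add_distrib, Finset.sum_add_distrib]
  have e' := congrArg (Nat.cast : ℕ → ℤ) e
  push_cast at e' ⊢
  rw [e', ← Finset.sum_add_distrib, ← Finset.sum_add_distrib, ← Finset.sum_add_distrib]
  rw [Finset.sum_congr rfl (g := fun _ => (1 : ℤ))]
  · simp
  · intro m hm
    rw [Finset.mem_range] at hm
    have := h.bounds (x := m + 1) (by omega) (by omega)
    split_ifs <;> omega

lemma sum_range_two_mul_add_one (n : ℕ) :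
    ∑ m ∈ Finset.range n, (2 * (m : ℤ) + 1) = n ^ 2 := by
  induction n with
  | zero => simp
  | succ n ih => rw [Finset.sum_range_succ, ih]; push_cast; ring

lemma ArcNC.majBW_add_imajBW (h : ArcNC n σ) :
    majBW (revW (word n σ)) + imajBW (revW (word n σ)) + 2 * peakSum (ncPath n σ) = 2 * n ^ 2 := by
  obtain ⟨V, hV, v1, v2, v3⟩ := h.revW_word
  obtain ⟨W, hW, w1, w2, w3⟩ := h.wInv_revW_word
  have hf := majW_of_descents (U := fun m => if σ m > m then 1 else 0)
    (Z := fun m => if σ m = m then 1 else 0) (A := fun m => if σ m = m + 1 then 1 else 0) hV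
    (by
      rcases Nat.eq_zero_or_pos n with rfl | h0
      · exact if_neg (by have := h.signed.2 0; simp at this; simp [this])
      · have := h.signed.bounds (x := n) (by omega) le_rfl
        exact if_neg (by omega))
    (fun m h1 h2 => by rw [h.descent_word v1 v2 v3 h1 h2]; push_cast; rfl)
  have hg := majW_of_descents (U := fun m => if σ.symm m > m then 1 else 0)
    (Z := fun m => if σ m = m then 1 else 0) (A := fun m => if σ m = m + 1 then 1 else 0) hW
    (by
      rcases Nat.eq_zero_or_pos n with rfl | h0
      · exact if_neg (by have := h.signed.symm.2 0; simp at this; simp [this])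
      · have := h.signed.symm.bounds (x := n) (by omega) le_rfl
        exact if_neg (by omega))
    (fun m h1 h2 => by rw [h.descent_inv w1 w2 w3 h1 h2]; push_cast; rfl)
  have hn := card_negSetW h.signed hV v1 v2
  have hn' := (card_negSetW h.signed.symm hW w1 w2).trans h.signed.card_symm_neg
  have hc := sum_count h.signed
  have hp := congrArg (Nat.cast : ℕ → ℤ) h.peakSum_ncPath
  have key : (majW (revW (word n σ)) : ℤ) + majW (wInv (revW (word n σ))) +
      ((Finset.range n).filter fun m : ℕ => σ (m + 1) < 0).card + peakSum (ncPath n σ) = n ^ 2 := by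
    have hs := sum_range_two_mul_add_one n
    have : (n : ℤ) = ∑ m ∈ Finset.range n, (1 : ℤ) := by simp
    rw [hf, hg, hp, ← hs]
    have hs' : ∑ m ∈ Finset.range n, (2 * (m : ℤ) + 1) =
        ∑ m ∈ Finset.range n, (2 * (m : ℤ)) + n := by
      rw [Finset.sum_add_distrib, ← this]
    rw [hs', ← hc, ← add_assoc, ← Finset.sum_add_distrib, ← Finset.sum_add_distrib, add_right_comm]
    congr 1
    push_cast
    rw [← Finset.sum_add_distrib]
    refine Finset.sum_congr rfl fun m _ => ?_
    split_ifs <;> ring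
  unfold imajBW majBW
  rw [hn, hn']
  zify
  linarith

end

section

lemma exists_first {P : ℤ → Prop} {a b : ℤ} (hab : a ≤ b) (ha : ¬P a) (hb : P b) :
    ∃ c, a < c ∧ c ≤ b ∧ P c ∧ ∀ x, a ≤ x → x < c → ¬P x := by
  obtain ⟨c, ⟨h1, h2⟩, h3⟩ := Int.exists_least_of_bdd (P := fun c => a ≤ c ∧ P c)
    ⟨a, fun z hz => hz.1⟩ ⟨b, hab, hb⟩
  refine ⟨c, lt_of_le_of_ne h1 ?_, h3 b ⟨hab, hb⟩, h2, fun x hx hxc hP => ?_⟩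
  · rintro rfl
    exact ha h2
  · exact absurd (h3 x ⟨hx, hP⟩) (by omega)

lemma exists_last {P : ℤ → Prop} {a b : ℤ} (hab : a ≤ b) (ha : P a) (hb : ¬P b) :
    ∃ c, a ≤ c ∧ c < b ∧ P c ∧ ∀ x, c < x → x ≤ b → ¬P x := by
  obtain ⟨c, ⟨h1, h2⟩, h3⟩ := Int.exists_greatest_of_bdd (P := fun c => c ≤ b ∧ P c)
    ⟨b, fun z hz => hz.1⟩ ⟨a, hab, ha⟩
  refine ⟨c, h3 a ⟨hab, ha⟩, lt_of_le_of_ne h1 ?_, h2, fun x hx hxc hP => ?_⟩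
  · rintro rfl
    exact hb h2
  · exact absurd (h3 x ⟨hxc, hP⟩) (by omega)

/-- `H` is the height function, read backwards, of a type `B_n` Dyck path: `H x` is the height
reached after `2n - x` steps. -/
structure RevHeight (n : ℕ) (H : ℤ → ℤ) : Prop where
  last : H (2 * n) = 0
  nonneg : ∀ x : ℤ, 0 ≤ x → x ≤ 2 * n → 0 ≤ H x
  step : ∀ x : ℤ, 1 ≤ x → x ≤ 2 * n → H x = H (x - 1) + 1 ∨ H x = H (x - 1) - 1

/-- The value `s` matched with `i` by the heights `H`, together with the reason. -/
def Matched (n : ℕ) (H : ℤ → ℤ) (i s : ℤ) : Prop :=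
  (i < s ∧ s ≤ n ∧ H (2 * i) = H (2 * i - 1) + 1 ∧ H (2 * s - 1) = H (2 * i) - 1 ∧
    ∀ x, 2 * i ≤ x → x < 2 * s - 1 → H (2 * i) ≤ H x) ∨
  (0 < s ∧ s ≤ i ∧ H (2 * i) = H (2 * i - 1) - 1 ∧ H (2 * s - 2) = H (2 * i) ∧
    ∀ x, 2 * s - 2 < x → x < 2 * i → H (2 * i) < H x) ∨
  (-n ≤ s ∧ s < 0 ∧ H (-(2 * s) - 1) = H 0 - H (2 * i) - 1 ∧
    (∀ x, 0 ≤ x → x < 2 * i → H (2 * i) < H x) ∧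
    ∀ x, 0 ≤ x → x < -(2 * s) - 1 → H (-(2 * s) - 1) < H x)

variable {n : ℕ} {H : ℤ → ℤ}

lemma RevHeight.emod_two (hH : RevHeight n H) {x : ℤ} (h1 : 0 ≤ x) (h2 : x ≤ 2 * n) :
    H x % 2 = x % 2 := by
  have key : ∀ d : ℕ, (d : ℤ) ≤ 2 * n → H (2 * n - d) % 2 = d % 2 := by
    intro d
    induction d with
    | zero => intro _; simp [hH.last]
    | succ d ih =>
      intro hd
      push_cast at hd ⊢
      have a1 := ih (by omega)
      have a2 := hH.step (2 * n - d) (by omega) (by omega)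
      rw [sub_sub] at a2
      omega
  have := key (2 * n - x).toNat (by omega)
  rw [Int.toNat_of_nonneg (by omega), sub_sub_cancel] at this
  omega

lemma RevHeight.exists_matched (hH : RevHeight n H) {i : ℤ} (h1 : 1 ≤ i) (h2 : i ≤ n) :
    ∃ s, Matched n H i s := by
  have p0 := hH.emod_two (x := 0) (by omega) (by omega)
  have pi := hH.emod_two (x := 2 * i) (by omega) (by omega)
  have ni := hH.nonneg (2 * i) (by omega) (by omega)
  have ni' := hH.nonneg (2 * i - 1) (by omega) (by omega)
  have hl := hH.last
  rcases hH.step (2 * i) (by omega) (by omega) with hs | hs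
  · obtain ⟨c, c1, c2, c3, c4⟩ := exists_first (P := fun x => H x < H (2 * i)) (a := 2 * i)
      (b := 2 * n) (by omega) (by omega) (by omega)
    have b1 := hH.step c (by omega) c2
    have b2 := c4 (c - 1) (by omega) (by omega)
    have b3 := hH.emod_two (x := c) (by omega) c2
    obtain ⟨s, rfl⟩ : ∃ s, c = 2 * s - 1 := ⟨(c + 1) / 2, by omega⟩
    exact ⟨s, Or.inl ⟨by omega, by omega, hs, by omega, fun x hx hx' => not_lt.1 (c4 x hx hx')⟩⟩
  · by_cases hex : ∃ x, 0 ≤ x ∧ x < 2 * i ∧ H x ≤ H (2 * i)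
    · obtain ⟨x, x1, x2, x3⟩ := hex
      obtain ⟨c, c1, c2, c3, c4⟩ := exists_last (P := fun x => H x ≤ H (2 * i)) (a := x)
        (b := 2 * i - 1) (by omega) x3 (by omega)
      have b1 := hH.step (c + 1) (by omega) (by omega)
      have b2 := c4 (c + 1) (by omega) (by omega)
      have b3 := hH.emod_two (x := c) (by omega) (by omega)
      rw [add_sub_cancel_right] at b1
      obtain ⟨s, rfl⟩ : ∃ s, c = 2 * s - 2 := ⟨(c + 2) / 2, by omega⟩
      exact ⟨s, Or.inr <| Or.inl ⟨by omega, by omega, hs, by omega,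
        fun y hy hy' => not_le.1 (c4 y hy (by omega))⟩⟩
    · push Not at hex
      have b0 := hex 0 le_rfl (by omega)
      obtain ⟨c, c1, c2, c3, c4⟩ := exists_first (P := fun x => H x ≤ H 0 - H (2 * i) - 1)
        (a := 0) (b := 2 * n) (by omega) (by omega) (by omega)
      have b1 := hH.step c (by omega) c2
      have b2 := c4 (c - 1) (by omega) (by omega)
      have b3 := hH.emod_two (x := c) (by omega) c2
      obtain ⟨s, rfl⟩ : ∃ s, c = -(2 * s) - 1 := ⟨-((c + 1) / 2), by omega⟩
      have b4 : H (-(2 * s) - 1) = H 0 - H (2 * i) - 1 := by omega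
      refine ⟨s, Or.inr <| Or.inr ⟨by omega, by omega, b4, hex, fun y hy hy' => ?_⟩⟩
      have := c4 y hy hy'
      omega

lemma Matched.bounds {i s : ℤ} (h : Matched n H i s) (h1 : 1 ≤ i) (h2 : i ≤ n) :
    s ≠ 0 ∧ -n ≤ s ∧ s ≤ n := by
  unfold Matched at h
  omega

lemma Matched.false_of_lt {i i' s : ℤ} (h : Matched n H i s) (h' : Matched n H i' s)
    (h1 : 1 ≤ i) (hi : i < i') : False := by
  rcases h with ⟨a1, a2, a3, a4, a5⟩ | ⟨a1, a2, a3, a4, a5⟩ | ⟨a1, a2, a3, a4, a5⟩ <;>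
  rcases h' with ⟨b1, b2, b3, b4, b5⟩ | ⟨b1, b2, b3, b4, b5⟩ | ⟨b1, b2, b3, b4, b5⟩ <;>
  try omega
  · have := a5 (2 * i' - 1) (by omega) (by omega)
    omega
  · have := a5 (2 * s - 2) (by omega) (by omega)
    have := b5 (2 * s - 1) (by omega) (by omega)
    omega
  · have := b5 (2 * i) (by omega) (by omega)
    omega
  · have := b4 (2 * i) (by omega) (by omega)
    omega

lemma Matched.false_of_neg {i i' s : ℤ} (h : Matched n H i s) (h' : Matched n H i' (-s))
    (h1 : 1 ≤ i) (h2 : i ≤ n) (h1' : 1 ≤ i') (hs : 0 < s) : False := by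
  rcases h' with ⟨b1, b2, b3, b4, b5⟩ | ⟨b1, b2, b3, b4, b5⟩ | ⟨b1, b2, b3, b4, b5⟩ <;>
  try omega
  rw [show -(2 * -s) - 1 = 2 * s - 1 by ring] at b3 b5
  rcases h with ⟨a1, a2, a3, a4, a5⟩ | ⟨a1, a2, a3, a4, a5⟩ | ⟨a1, a2, a3, a4, a5⟩
  · have := b5 (2 * i - 1) (by omega) (by omega)
    omega
  · have := b5 (2 * s - 2) (by omega) (by omega)
    rcases eq_or_lt_of_le a2 with rfl | hlt
    · omega
    · have := a5 (2 * s - 1) (by omega) (by omega)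
      omega
  · omega

end

section
variable {n : ℕ} {H : ℤ → ℤ} {σ : Equiv.Perm ℤ}

lemma RevHeight.exists_perm (hH : RevHeight n H) :
    ∃ σ : Equiv.Perm ℤ, IsSignedPerm n σ ∧ ∀ i : ℤ, 1 ≤ i → i ≤ n → Matched n H i (σ i) := by
  have hex : ∀ i : ℤ, ∃ s, 1 ≤ i → i ≤ n → Matched n H i s := by
    intro i
    by_cases hi : 1 ≤ i ∧ i ≤ n
    · obtain ⟨s, hs⟩ := hH.exists_matched hi.1 hi.2
      exact ⟨s, fun _ _ => hs⟩
    · exact ⟨0, fun h1 h2 => absurd ⟨h1, h2⟩ hi⟩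
  choose s hs using hex
  have hb : ∀ i : ℤ, 1 ≤ i → i ≤ n → s i ≠ 0 ∧ -n ≤ s i ∧ s i ≤ n :=
    fun i h1 h2 => (hs i h1 h2).bounds h1 h2
  have hinj : ∀ i j : ℤ, 1 ≤ i → i ≤ n → 1 ≤ j → j ≤ n → s i = s j → i = j := by
    intro i j hi hi' hj hj' hij
    rcases lt_trichotomy i j with h | h | h
    · exact ((hij ▸ hs i hi hi').false_of_lt (hs j hj hj') hi h).elim
    · exact h
    · exact ((hij ▸ hs j hj hj').false_of_lt (hs i hi hi') hj h).elim
  have hneg : ∀ i j : ℤ, 1 ≤ i → i ≤ n → 1 ≤ j → j ≤ n → s i ≠ -s j := by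
    intro i j hi hi' hj hj' hij
    have a1 := hs i hi hi'
    have a2 := hs j hj hj'
    rcases lt_or_gt_of_ne (hb i hi hi').1 with h | h
    · rw [hij] at a1
      exact a2.false_of_neg a1 hj hj' hi (by omega)
    · rw [show s j = -s i by omega] at a2
      exact a1.false_of_neg a2 hi hi' hj h
  set f : ℤ → ℤ := fun x => if 1 ≤ x ∧ x ≤ n then s x else
    if -n ≤ x ∧ x ≤ -1 then -s (-x) else x with hf
  have f1 : ∀ x : ℤ, 1 ≤ x → x ≤ n → f x = s x := fun x h1 h2 => if_pos ⟨h1, h2⟩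
  have f2 : ∀ x : ℤ, -n ≤ x → x ≤ -1 → f x = -s (-x) := fun x h1 h2 => by
    rw [hf]
    dsimp only
    rw [if_neg (by omega), if_pos ⟨h1, h2⟩]
  have f3 : ∀ x : ℤ, (x < -n ∨ x = 0 ∨ n < x) → f x = x := fun x h => by
    rw [hf]
    dsimp only
    rw [if_neg (by omega), if_neg (by omega)]
  have fcases : ∀ x : ℤ, (1 ≤ x ∧ x ≤ n) ∨ (-n ≤ x ∧ x ≤ -1) ∨ x < -n ∨ x = 0 ∨ n < x := by
    intro x
    omega
  have finj : Function.Injective f := by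
    intro x y hxy
    rcases fcases x with hx | hx | hx <;> rcases fcases y with hy | hy | hy
    · rw [f1 x hx.1 hx.2, f1 y hy.1 hy.2] at hxy
      exact hinj x y hx.1 hx.2 hy.1 hy.2 hxy
    · rw [f1 x hx.1 hx.2, f2 y hy.1 hy.2] at hxy
      exact (hneg x (-y) hx.1 hx.2 (by omega) (by omega) hxy).elim
    · rw [f1 x hx.1 hx.2, f3 y hy] at hxy
      have := hb x hx.1 hx.2
      omega
    · rw [f2 x hx.1 hx.2, f1 y hy.1 hy.2] at hxy
      exact (hneg y (-x) hy.1 hy.2 (by omega) (by omega) hxy.symm).elim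
    · rw [f2 x hx.1 hx.2, f2 y hy.1 hy.2] at hxy
      have := hinj (-x) (-y) (by omega) (by omega) (by omega) (by omega) (neg_injective hxy)
      omega
    · rw [f2 x hx.1 hx.2, f3 y hy] at hxy
      have := hb (-x) (by omega) (by omega)
      omega
    · rw [f3 x hx, f1 y hy.1 hy.2] at hxy
      have := hb y hy.1 hy.2
      omega
    · rw [f3 x hx, f2 y hy.1 hy.2] at hxy
      have := hb (-y) (by omega) (by omega)
      omega
    · rwa [f3 x hx, f3 y hy] at hxy
  have fsurj : Function.Surjective f := by
    intro y
    by_cases hy : y < -n ∨ n < y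
    · exact ⟨y, f3 y (by omega)⟩
    · have hmaps : Set.MapsTo f (Finset.Icc (-n : ℤ) n) (Finset.Icc (-n : ℤ) n) := by
        intro x hx
        rw [Finset.mem_coe, Finset.mem_Icc] at hx ⊢
        rcases fcases x with h | h | h
        · rw [f1 x h.1 h.2]
          have := hb x h.1 h.2
          omega
        · rw [f2 x h.1 h.2]
          have := hb (-x) (by omega) (by omega)
          omega
        · rwa [f3 x h]
      obtain ⟨x, -, hx⟩ := Finset.surjOn_of_injOn_of_card_le f hmaps finj.injOn le_rfl
        (show y ∈ ((Finset.Icc (-n : ℤ) n : Finset ℤ) : Set ℤ) by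
          rw [Finset.mem_coe, Finset.mem_Icc]; omega)
      exact ⟨x, hx⟩
  obtain ⟨g, hg⟩ : ∃ g : Equiv.Perm ℤ, ∀ x, g x = f x :=
    ⟨Equiv.ofBijective f ⟨finj, fsurj⟩, fun _ => rfl⟩
  refine ⟨g, ⟨fun x => ?_, fun x hx => ?_⟩, fun i h1 h2 => ?_⟩
  · rw [hg, hg]
    rcases fcases x with h | h | h
    · rw [f1 x h.1 h.2, f2 (-x) (by omega) (by omega), neg_neg]
    · rw [f2 x h.1 h.2, f1 (-x) (by omega) (by omega), neg_neg]
    · rw [f3 x h, f3 (-x) (by omega)]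
  · rw [hg]
    refine f3 x ?_
    rcases abs_cases x with h | h <;> omega
  · rw [hg, f1 i h1 h2]
    exact hs i h1 h2

lemma arcNC_of_matched (hσ : IsSignedPerm n σ)
    (hm : ∀ i : ℤ, 1 ≤ i → i ≤ n → Matched n H i (σ i)) : ArcNC n σ := by
  have hfix : ∀ i : ℤ, 1 ≤ i → σ i ≠ i → i ≤ n := by
    intro i h1 h2
    by_contra h
    exact h2 (hσ.apply_eq_self (by omega))
  refine ⟨hσ, fun i x h1 h2 h3 => ?_, fun i x h1 h2 h3 => ?_, fun i x h1 h2 h3 h4 => ?_,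
    fun i x h1 h2 h3 h4 => ?_⟩
  · have hi := hfix i h1 (by omega)
    have hb := hσ.bounds h1 hi
    rcases hm i h1 hi with ⟨a1, a2, a3, a4, a5⟩ | ⟨a1, a2, a3, a4, a5⟩ | ⟨a1, a2, a3, a4, a5⟩ <;>
    try omega
    have e1 := a5 (2 * x) (by omega) (by omega)
    have e2 := a5 (2 * x - 1) (by omega) (by omega)
    rcases hm x (by omega) (by omega) with
      ⟨b1, b2, b3, b4, b5⟩ | ⟨b1, b2, b3, b4, b5⟩ | ⟨b1, b2, b3, b4, b5⟩
    · refine ⟨by omega, ?_⟩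
      by_contra hc
      rcases eq_or_lt_of_le (not_lt.1 hc) with he | hlt
      · rw [← he] at b4
        omega
      · have := b5 (2 * σ i - 1) (by omega) (by omega)
        omega
    · refine ⟨?_, by omega⟩
      by_contra hc
      have := b5 (2 * i - 1) (by omega) (by omega)
      omega
    · have := b4 (2 * i - 1) (by omega) (by omega)
      omega
  · rcases eq_or_lt_of_le h3 with rfl | h3
    · omega
    have hi : i ≤ n := hfix i (by omega) (by omega)
    rcases hm i (by omega) hi with
      ⟨a1, a2, a3, a4, a5⟩ | ⟨a1, a2, a3, a4, a5⟩ | ⟨a1, a2, a3, a4, a5⟩ <;>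
    try omega
    have e1 := a5 (2 * x) (by omega) (by omega)
    rcases hm x (by omega) (by omega) with
      ⟨b1, b2, b3, b4, b5⟩ | ⟨b1, b2, b3, b4, b5⟩ | ⟨b1, b2, b3, b4, b5⟩
    · refine ⟨by omega, ?_⟩
      by_contra hc
      have := b5 (2 * i) (by omega) (by omega)
      omega
    · refine ⟨?_, by omega⟩
      by_contra hc
      have := b5 (2 * σ i - 2) (by omega) (by omega)
      omega
    · have := b4 (2 * σ i - 2) (by omega) (by omega)
      omega
  · have hi := hfix i h1 (by omega)
    have hb := hσ.bounds h1 hi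
    rcases hm i h1 hi with ⟨a1, a2, a3, a4, a5⟩ | ⟨a1, a2, a3, a4, a5⟩ | ⟨a1, a2, a3, a4, a5⟩ <;>
    try omega
    have e1 := a5 (2 * x) (by omega) (by omega)
    have e2 := a5 (2 * x - 1) (by omega) (by omega)
    rcases hm x (by omega) (by omega) with
      ⟨b1, b2, b3, b4, b5⟩ | ⟨b1, b2, b3, b4, b5⟩ | ⟨b1, b2, b3, b4, b5⟩
    · refine Or.inl ⟨by omega, ?_⟩
      by_contra hc
      rcases eq_or_lt_of_le (not_lt.1 hc) with he | hlt
      · rw [← he, show 2 * -σ i - 1 = -(2 * σ i) - 1 by ring] at b4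
        omega
      · have := b5 (-(2 * σ i) - 1) (by omega) (by omega)
        omega
    · omega
    · refine Or.inr ?_
      by_contra hc
      have := a4 (-(2 * σ x) - 1) (by omega) (by omega)
      omega
  · have hi := hfix i h1 (by omega)
    rcases hm i h1 hi with ⟨a1, a2, a3, a4, a5⟩ | ⟨a1, a2, a3, a4, a5⟩ | ⟨a1, a2, a3, a4, a5⟩ <;>
    try omega
    rcases hm x (by omega) h4 with
      ⟨b1, b2, b3, b4, b5⟩ | ⟨b1, b2, b3, b4, b5⟩ | ⟨b1, b2, b3, b4, b5⟩
    · omega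
    · refine Or.inl ?_
      by_contra hc
      have e1 := b5 (2 * i) (by omega) (by omega)
      have := a4 (2 * σ x - 2) (by omega) (by omega)
      omega
    · refine Or.inr ⟨?_, b2⟩
      by_contra hc
      have e1 := b4 (2 * i) (by omega) (by omega)
      rcases eq_or_lt_of_le (not_lt.1 hc) with he | hlt
      · rw [he] at b3
        omega
      · have := b5 (-(2 * σ i) - 1) (by omega) (by omega)
        omega

/-- The height of the path `w` after `2n - x` steps. -/
noncomputable def revHeight (n : ℕ) (w : Fin (2 * n) → Bool) (x : ℤ) : ℤ :=
  countN w (2 * n - x).toNat - countE w (2 * n - x).toNat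

lemma card_filter_lt_succ {L : ℕ} (w : Fin L → Bool) (b : Bool) {k : ℕ} (hk : k < L) :
    (Finset.univ.filter fun t : Fin L => (t : ℕ) < k + 1 ∧ w t = b).card =
      (Finset.univ.filter fun t : Fin L => (t : ℕ) < k ∧ w t = b).card +
        if letterAt w k = b then 1 else 0 := by
  have hl : letterAt w k = w ⟨k, hk⟩ := dif_pos _
  rw [hl, Finset.card_filter, Finset.card_filter,
    ← Finset.sum_ite_eq_of_mem' Finset.univ (⟨k, hk⟩ : Fin L)
      (fun t => if w t = b then 1 else 0) (Finset.mem_univ _), ← Finset.sum_add_distrib]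
  refine Finset.sum_congr rfl fun t _ => ?_
  by_cases ht : t = ⟨k, hk⟩
  · subst ht
    simp
  · have : (t : ℕ) ≠ k := fun h => ht (Fin.ext h)
    rw [if_neg ht, add_zero]
    exact if_congr (by rw [show (t : ℕ) < k + 1 ↔ (t : ℕ) < k by omega]) rfl rfl

lemma revHeight_pred (w : Fin (2 * n) → Bool) {p : ℕ} (h1 : 1 ≤ p) (h2 : p ≤ 2 * n) :
    revHeight n w (p - 1) =
      revHeight n w p + if letterAt w (2 * n - p) = true then 1 else -1 := by
  unfold revHeight
  rw [show (2 * n - (p : ℤ)).toNat = 2 * n - p by omega,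
    show (2 * n - ((p : ℤ) - 1)).toNat = 2 * n - p + 1 by omega, countN, countE,
    card_filter_lt_succ w true (by omega), card_filter_lt_succ w false (by omega), countN, countE]
  cases letterAt w (2 * n - p) <;> simp <;> ring

lemma IsDyckB.revHeight {w : Fin (2 * n) → Bool} (hw : IsDyckB n w) :
    RevHeight n (revHeight n w) := by
  refine ⟨?_, fun x _ _ => ?_, fun x h1 h2 => ?_⟩
  · simp [Stmt.revHeight, countN_zero, countE_zero]
  · unfold Stmt.revHeight
    have := hw (2 * n - x).toNat
    omega
  · lift x to ℕ using by omega
    have := revHeight_pred w (p := x) (by omega) (by omega)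
    split_ifs at this <;> omega

lemma ncPath_eq_of_matched {w : Fin (2 * n) → Bool} (hσ : IsSignedPerm n σ)
    (hm : ∀ i : ℤ, 1 ≤ i → i ≤ n → Matched n (revHeight n w) i (σ i)) : ncPath n σ = w := by
  have hL : ∀ (v : Fin (2 * n) → Bool) (q : Fin (2 * n)), v q = letterAt v q :=
    fun v q => by unfold letterAt; rw [dif_pos q.2]
  funext q
  have hq := q.2
  rw [hL (ncPath n σ) q, hL w q]
  obtain ⟨i, hi⟩ := Nat.even_or_odd' (q : ℕ)
  rw [Bool.eq_iff_iff]
  rcases hi with hi | hi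
  · have hp := revHeight_pred w (p := 2 * (n - i)) (by omega) (by omega)
    have e := letterAt_ncPath_even (n := n) (σ := σ) (i := n - i) (by omega) (by omega)
    rw [show 2 * n - 2 * (n - i) = q by omega] at hp e
    rw [e]
    have := hm (n - i : ℕ) (by omega) (by omega)
    push_cast at hp
    rcases this with ⟨a1, a2, a3, a4, a5⟩ | ⟨a1, a2, a3, a4, a5⟩ | ⟨a1, a2, a3, a4, a5⟩
    · split_ifs at hp with hl <;> simp only [hl, iff_true, Bool.false_eq_true, iff_false] <;> omega
    · split_ifs at hp with hl <;> simp only [hl, iff_true, Bool.false_eq_true, iff_false] <;> omega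
    · have := a4 (2 * (n - i : ℕ) - 1) (by omega) (by omega)
      split_ifs at hp with hl <;> simp only [hl, iff_true, Bool.false_eq_true, iff_false] <;> omega
  · have hp := revHeight_pred w (p := 2 * (n - i) - 1) (by omega) (by omega)
    have e := letterAt_ncPath_odd (n := n) (σ := σ) (i := n - i) (by omega) (by omega)
    rw [show 2 * n - (2 * (n - i) - 1) = q by omega] at hp e
    rw [e]
    have hb := hσ.symm.bounds (x := (n - i : ℕ)) (by omega) (by omega)
    rw [show ((2 * (n - i) - 1 : ℕ) : ℤ) = 2 * (n - i : ℕ) - 1 by omega] at hp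
    rw [show (2 * (n - i : ℕ) - 1 - 1 : ℤ) = 2 * (n - i : ℕ) - 2 by ring] at hp
    rcases lt_or_gt_of_ne hb.1 with h | h
    · have := hm (-σ.symm (n - i : ℕ)) (by omega) (by omega)
      rw [hσ.1, Equiv.apply_symm_apply] at this
      rcases this with ⟨a1, a2, a3, a4, a5⟩ | ⟨a1, a2, a3, a4, a5⟩ | ⟨a1, a2, a3, a4, a5⟩ <;>
      try omega
      rw [show -(2 * -((n - i : ℕ) : ℤ)) - 1 = 2 * (n - i : ℕ) - 1 by ring] at a3 a5
      have := a5 (2 * (n - i : ℕ) - 2) (by omega) (by omega)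
      split_ifs at hp with hl <;> simp only [hl, iff_true, Bool.false_eq_true, iff_false] <;> omega
    · have := hm (σ.symm (n - i : ℕ)) (by omega) (by omega)
      rw [Equiv.apply_symm_apply] at this
      rcases this with ⟨a1, a2, a3, a4, a5⟩ | ⟨a1, a2, a3, a4, a5⟩ | ⟨a1, a2, a3, a4, a5⟩
      · have := a5 (2 * (n - i : ℕ) - 2) (by omega) (by omega)
        split_ifs at hp with hl <;> simp only [hl, iff_true, Bool.false_eq_true, iff_false] <;> omega
      · rcases eq_or_lt_of_le a2 with he | hlt
        · rw [← he] at a3 a4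
          split_ifs at hp with hl <;> simp only [hl, iff_true, Bool.false_eq_true, iff_false] <;> omega
        · have := a5 (2 * (n - i : ℕ) - 1) (by omega) (by omega)
          split_ifs at hp with hl <;> simp only [hl, iff_true, Bool.false_eq_true, iff_false] <;> omega
      · omega

lemma IsDyckB.exists_ncPath_eq {w : Fin (2 * n) → Bool} (hw : IsDyckB n w) :
    ∃ σ, ArcNC n σ ∧ ncPath n σ = w := by
  obtain ⟨σ, h1, h2⟩ := hw.revHeight.exists_perm
  exact ⟨σ, arcNC_of_matched h1 h2, ncPath_eq_of_matched h1 h2⟩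

lemma IsDyckB.peakSum_le {w : Fin (2 * n) → Bool} (hw : IsDyckB n w) : peakSum w ≤ n ^ 2 := by
  obtain ⟨σ, h, rfl⟩ := hw.exists_ncPath_eq
  have := h.majBW_add_imajBW
  omega

end

/-- For every `n ≥ 1` and every `k`, type `B_n` Dyck paths with type `B` major
index `k` are equinumerous with non-crossing signed permutations `σ ∈ NC(B_n)`
with `maj_B(rev(σ)) + imaj_B(rev(σ)) = k`. -/
theorem majB_eq_majBimajB_rev_NCB (n : ℕ) (hn : 1 ≤ n) (k : ℕ) :
    {w : Fin (2 * n) → Bool | IsDyckB n w ∧ majB n w = k}.ncard =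
      {σ : Equiv.Perm ℤ | IsNCB n σ ∧
        majBW (revW (word n σ)) + imajBW (revW (word n σ)) = k}.ncard := by
  have hR : {σ : Equiv.Perm ℤ | IsNCB n σ ∧
      majBW (revW (word n σ)) + imajBW (revW (word n σ)) = k}.ncard =
      {w : Fin (2 * n) → Bool | IsDyckB n w ∧ 2 * (n ^ 2 - peakSum w) = k}.ncard := by
    rw [← Set.InjOn.ncard_image (f := ncPath n) (s := {σ : Equiv.Perm ℤ | IsNCB n σ ∧
      majBW (revW (word n σ)) + imajBW (revW (word n σ)) = k})
      fun σ hσ τ hτ h => ncPath_injOn hσ.1.arcNC hτ.1.arcNC h]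
    congr 1
    ext w
    constructor
    · rintro ⟨σ, ⟨h1, h2⟩, rfl⟩
      have h3 := h1.arcNC.majBW_add_imajBW
      exact ⟨h1.1.isDyckB_ncPath, by omega⟩
    · rintro ⟨hw, hk⟩
      obtain ⟨σ, h, rfl⟩ := hw.exists_ncPath_eq
      have h3 := h.majBW_add_imajBW
      exact ⟨σ, ⟨h.isNCB, by omega⟩, rfl⟩
  have hL : {w : Fin (2 * n) → Bool | IsDyckB n w ∧ majB n w = k} =
      {w : Fin (2 * n) → Bool | IsDyckB n w ∧ 2 * peakSum w = k} := by
    ext w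
    exact and_congr_right fun hw => by rw [majB_eq_two_mul_peakSum hw]
  rw [hR, hL]
  rcases Nat.even_or_odd' k with ⟨m, rfl | rfl⟩
  · have := card_peakSum_symm (n := n) (fun w hw => hw.peakSum_le) m
    rw [← Set.ncard_coe_finset, ← Set.ncard_coe_finset] at this
    simpa using this
  · congr 1
    ext w
    constructor <;> rintro ⟨-, h⟩ <;> omega

end Stmt
end

section
/- For every n ≥ 1 there exists a bijection γ from the set D_n of Dyck paths of length n onto the set S_n(231) of 231-avoiding permutations of {1,…,n} such that for every w ∈ D_n both area(w) = inv(γ(w)) and maj(w) + maj(γ(w)) + imaj(γ(w)) = n(n−1). -/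
open scoped Classical

namespace Stmt

/-- Number of inversions of a permutation of `{1,…,n}`. -/
def invP {n : ℕ} (σ : Equiv.Perm (Fin n)) : ℕ :=
  (Finset.univ.filter (fun p : Fin n × Fin n => p.1 < p.2 ∧ σ p.2 < σ p.1)).card

/-- Descent set of a permutation, as 1-indexed positions in `{1,…,n-1}`. -/
def permDes {n : ℕ} (σ : Equiv.Perm (Fin n)) : Finset ℕ :=
  (Finset.Ico 1 n).filter (fun i =>
    ∃ h : i < n, σ ⟨i, h⟩ < σ ⟨i - 1, Nat.lt_of_le_of_lt (Nat.sub_le i 1) h⟩)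

def desP {n : ℕ} (σ : Equiv.Perm (Fin n)) : ℕ := (permDes σ).card

def majP {n : ℕ} (σ : Equiv.Perm (Fin n)) : ℕ := ∑ i ∈ permDes σ, i

def imajP {n : ℕ} (σ : Equiv.Perm (Fin n)) : ℕ := majP σ⁻¹

/-- `σ` is 231-avoiding: no `i < j < k` with `σ k < σ i < σ j`. -/
def Avoids231 {n : ℕ} (σ : Equiv.Perm (Fin n)) : Prop :=
  ¬ ∃ i j k : Fin n, i < j ∧ j < k ∧ σ k < σ i ∧ σ i < σ j

section Permutations

/-- Sum of the weights `g i` over the descents of the word `f 0, …, f (n - 1)`, where a descent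
is recorded at the index of its second letter. -/
def descSum (g f : ℕ → ℕ) (n : ℕ) : ℕ :=
  ∑ i ∈ Finset.range n, if 0 < i ∧ f i < f (i - 1) then g i else 0

/-- Number of inversions of the word `f 0, …, f (n - 1)`. -/
def invCount (f : ℕ → ℕ) (n : ℕ) : ℕ :=
  ∑ i ∈ Finset.range n, ∑ j ∈ Finset.range n, if i < j ∧ f j < f i then 1 else 0

lemma descSum_congr {f f' : ℕ → ℕ} {n : ℕ} (g : ℕ → ℕ) (c : ℕ)
    (h : ∀ i < n, f i = f' i + c) : descSum g f n = descSum g f' n := by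
  refine Finset.sum_congr rfl fun i hi => ?_
  have hi := Finset.mem_range.1 hi
  rw [h i hi, h (i - 1) (by omega)]
  simp

lemma invCount_congr {f f' : ℕ → ℕ} {n : ℕ} (c : ℕ)
    (h : ∀ i < n, f i = f' i + c) : invCount f n = invCount f' n := by
  refine Finset.sum_congr rfl fun i hi => Finset.sum_congr rfl fun j hj => ?_
  rw [h i (Finset.mem_range.1 hi), h j (Finset.mem_range.1 hj)]
  simp

lemma descSum_add (g f : ℕ → ℕ) (a b : ℕ) :
    descSum g f (a + b) = descSum g f a
      + (if 0 < a ∧ 0 < b ∧ f a < f (a - 1) then g a else 0)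
      + descSum (fun i => g (a + i)) (fun i => f (a + i)) b := by
  unfold descSum
  rw [Finset.sum_range_add, add_assoc]
  congr 1
  cases b with
  | zero => simp
  | succ b =>
    rw [Finset.sum_range_succ', Finset.sum_range_succ' (n := b)]
    simp only [add_zero, lt_irrefl, false_and, if_false, Nat.add_sub_cancel]
    rw [add_comm]
    congr 1
    · simp
    · refine Finset.sum_congr rfl fun i _ => ?_
      simp [← add_assoc]

lemma invCount_add (f : ℕ → ℕ) (a b : ℕ) :
    invCount f (a + b) = invCount f a
      + (∑ i ∈ Finset.range a, ∑ j ∈ Finset.range b, if f (a + j) < f i then 1 else 0)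
      + invCount (fun i => f (a + i)) b := by
  have h1 : ∑ i ∈ Finset.range a, ∑ j ∈ Finset.range b,
      (if i < a + j ∧ f (a + j) < f i then 1 else 0) =
      ∑ i ∈ Finset.range a, ∑ j ∈ Finset.range b, if f (a + j) < f i then 1 else 0 := by
    refine Finset.sum_congr rfl fun i hi => Finset.sum_congr rfl fun j hj => ?_
    have := Finset.mem_range.1 hi
    simp [show i < a + j by omega]
  have h2 : ∑ i ∈ Finset.range b, ∑ j ∈ Finset.range a,
      (if a + i < j ∧ f j < f (a + i) then 1 else 0) = 0 := by
    refine Finset.sum_eq_zero fun i hi => Finset.sum_eq_zero fun j hj => ?_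
    have := Finset.mem_range.1 hj
    rw [if_neg (by omega)]
  simp only [invCount, Finset.sum_range_add, Finset.sum_add_distrib, h1, h2,
    add_lt_add_iff_left]
  omega

lemma majP_eq_descSum {n : ℕ} {σ : Equiv.Perm (Fin n)} {f : ℕ → ℕ}
    (h : ∀ i : Fin n, (σ i : ℕ) = f i) : majP σ = descSum id f n := by
  unfold majP descSum
  rw [← Finset.sum_filter]
  refine Finset.sum_congr ?_ fun _ _ => rfl
  ext i
  simp only [permDes, Finset.mem_filter, Finset.mem_Ico, Finset.mem_range, Fin.lt_def, h]
  constructor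
  · rintro ⟨⟨h1, h2⟩, _, h3⟩
    exact ⟨h2, h1, h3⟩
  · rintro ⟨h2, h1, h3⟩
    exact ⟨⟨h1, h2⟩, h2, h3⟩

lemma invP_eq_invCount {n : ℕ} {σ : Equiv.Perm (Fin n)} {f : ℕ → ℕ}
    (h : ∀ i : Fin n, (σ i : ℕ) = f i) : invP σ = invCount f n := by
  unfold invP invCount
  simp only [Finset.card_filter, Fintype.sum_prod_type, Fin.lt_def, h]
  rw [← Fin.sum_univ_eq_sum_range
    (fun i => ∑ j ∈ Finset.range n, if i < j ∧ f j < f i then 1 else 0)]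
  refine Finset.sum_congr rfl fun i _ => ?_
  exact Fin.sum_univ_eq_sum_range (fun j => if (i : ℕ) < j ∧ f j < f i then 1 else 0) n

/-- The permutation of `{0, …, t.numNodes - 1}` attached to a binary tree: the maximum is placed
between the permutation of the right subtree and the shifted permutation of the left subtree. -/
def treePerm : BinaryTree Unit → ℕ → ℕ
  | .nil, i => i
  | .node _ l r, i =>
    if i < r.numNodes then treePerm r i
    else if i = r.numNodes then l.numNodes + r.numNodes
    else treePerm l (i - r.numNodes - 1) + r.numNodes

/-- The inverse of `treePerm`. -/
def treePermInv : BinaryTree Unit → ℕ → ℕ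
  | .nil, i => i
  | .node _ l r, i =>
    if i < r.numNodes then treePermInv r i
    else if i = l.numNodes + r.numNodes then r.numNodes
    else treePermInv l (i - r.numNodes) + r.numNodes + 1

open BinaryTree

lemma treePerm_lt (t : BinaryTree Unit) : ∀ i < t.numNodes, treePerm t i < t.numNodes := by
  induction t with
  | nil => simp
  | node _ l r hl hr =>
    intro i hi
    simp only [numNodes, treePerm] at hi ⊢
    have := hl (i - r.numNodes - 1)
    have := hr i
    split_ifs <;> omega

lemma treePermInv_lt (t : BinaryTree Unit) : ∀ i < t.numNodes, treePermInv t i < t.numNodes := by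
  induction t with
  | nil => simp
  | node _ l r hl hr =>
    intro i hi
    simp only [numNodes, treePermInv] at hi ⊢
    have := hl (i - r.numNodes)
    have := hr i
    split_ifs <;> omega

lemma treePermInv_treePerm (t : BinaryTree Unit) :
    ∀ i < t.numNodes, treePermInv t (treePerm t i) = i := by
  induction t with
  | nil => simp
  | node _ l r hl hr =>
    intro i hi
    simp only [numNodes] at hi
    rcases lt_trichotomy i r.numNodes with h | h | h
    · have := treePerm_lt r i h
      simp [treePerm, treePermInv, h, this, hr]
    · simp [treePerm, treePermInv, h]
    · have h1 := treePerm_lt l (i - r.numNodes - 1) (by omega)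
      have h2 := hl (i - r.numNodes - 1) (by omega)
      simp only [treePerm, treePermInv, if_neg h.not_gt, if_neg h.ne']
      rw [if_neg (by omega), if_neg (by omega), Nat.add_sub_cancel, h2]
      omega

lemma treePerm_treePermInv (t : BinaryTree Unit) :
    ∀ i < t.numNodes, treePerm t (treePermInv t i) = i := by
  induction t with
  | nil => simp
  | node _ l r hl hr =>
    intro i hi
    simp only [numNodes] at hi
    by_cases h : i < r.numNodes
    · have := treePermInv_lt r i h
      simp [treePerm, treePermInv, h, this, hr]
    by_cases h' : i = l.numNodes + r.numNodes
    · simp [treePerm, treePermInv, h']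
    · have h2 := hl (i - r.numNodes) (by omega)
      simp only [treePerm, treePermInv, if_neg h, if_neg h']
      rw [if_neg (by omega), if_neg (by omega),
        show treePermInv l (i - r.numNodes) + r.numNodes + 1 - r.numNodes - 1 =
          treePermInv l (i - r.numNodes) by omega, h2]
      omega

lemma treePerm_avoids (t : BinaryTree Unit) : ∀ i j k : ℕ, i < j → j < k → k < t.numNodes →
    treePerm t k < treePerm t i → treePerm t j < treePerm t i := by
  induction t with
  | nil => simp
  | node _ l r hl hr =>
    intro i j k hij hjk hk
    simp only [numNodes] at hk
    have h1 := hl (i - r.numNodes - 1) (j - r.numNodes - 1) (k - r.numNodes - 1)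
    have h2 := hr i j k hij hjk
    have h3 := treePerm_lt r i
    have h4 := treePerm_lt l (j - r.numNodes - 1)
    have h5 := treePerm_lt r j
    simp only [treePerm]
    split_ifs <;> omega

lemma treePerm_injective {t t' : BinaryTree Unit} (hn : t.numNodes = t'.numNodes)
    (h : ∀ i < t.numNodes, treePerm t i = treePerm t' i) : t = t' := by
  induction t generalizing t' with
  | nil =>
    cases t' with
    | nil => rfl
    | node => simp [numNodes] at hn
  | node _ l r hl hr =>
    cases t' with
    | nil => simp [numNodes] at hn
    | node _ l' r' =>
      simp only [numNodes] at hn h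
      have hr' : r.numNodes = r'.numNodes := by
        have h1 := h r.numNodes (by omega)
        have h2 := h r'.numNodes
        have h3 := treePerm_lt r' r.numNodes
        have h4 := treePerm_lt l' (r.numNodes - r'.numNodes - 1)
        simp only [treePerm, lt_irrefl, if_false, if_true] at h1
        split_ifs at h1 <;> omega
      have hl' : l.numNodes = l'.numNodes := by omega
      have e1 : r = r' := hr hr' fun i hi => by
        have := h i (by omega)
        simpa [treePerm, hi, hr' ▸ hi] using this
      have e2 : l = l' := hl hl' fun i hi => by
        have := h (i + r.numNodes + 1) (by omega)
        simp only [treePerm, ← hr'] at this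
        rw [if_neg (by omega), if_neg (by omega), if_neg (by omega), if_neg (by omega),
          show i + r.numNodes + 1 - r.numNodes - 1 = i by omega] at this
        omega
      rw [e1, e2]

lemma exists_treePerm_eq (n : ℕ) (f : ℕ → ℕ) (hf : ∀ i < n, f i < n)
    (hinj : ∀ i < n, ∀ j < n, f i = f j → i = j)
    (hav : ∀ i j k : ℕ, i < j → j < k → k < n → f k < f i → f j < f i) :
    ∃ t : BinaryTree Unit, t.numNodes = n ∧ ∀ i < n, treePerm t i = f i := by
  induction n using Nat.strong_induction_on generalizing f with
  | _ n ih =>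
    obtain rfl | hn := n.eq_zero_or_pos
    · exact ⟨.nil, rfl, by simp⟩
    have hsurj : ∃ k < n, f k = n - 1 := by
      have := Finset.surj_on_of_inj_on_of_card_le (s := Finset.range n) (t := Finset.range n)
        (fun i _ => f i) (by simpa using hf) (by simpa using fun i j hi hj => hinj i hi j hj)
        le_rfl (n - 1) (by simp; omega)
      obtain ⟨k, hk, e⟩ := this
      exact ⟨k, by simpa using hk, e.symm⟩
    obtain ⟨k, hk, hfk⟩ := hsurj
    have hlt : ∀ i < k, ∀ j, k < j → j < n → f i < f j := by
      intro i hi j hj hjn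
      have h1 := hav i k j hi hj hjn
      have h2 := hf i (by omega)
      have h3 := hinj i (by omega) j hjn
      omega
    have hsmall : ∀ i < k, f i < k := by
      intro i hi
      have hcard : (Finset.Ico k n).card ≤ (Finset.Ioo (f i) n).card := by
        refine Finset.card_le_card_of_injOn f (fun j hj => ?_) fun a ha b hb e => ?_
        · simp only [Finset.coe_Ico, Set.mem_Ico] at hj
          simp only [Finset.coe_Ioo, Set.mem_Ioo]
          refine ⟨?_, hf j hj.2⟩
          rcases hj.1.eq_or_lt with rfl | h
          · have h2 := hf i (by omega)
            have h3 := hinj i (by omega) k hk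
            omega
          · exact hlt i hi j h hj.2
        · simp only [Finset.coe_Ico, Set.mem_Ico] at ha hb
          exact hinj a ha.2 b hb.2 e
      have := hf i (by omega)
      simp only [Nat.card_Ico, Nat.card_Ioo] at hcard
      omega
    have hlarge : ∀ j, k < j → j < n → k ≤ f j := by
      intro j hj hjn
      have hcard : (Finset.range k).card ≤ (Finset.range (f j)).card := by
        refine Finset.card_le_card_of_injOn f (fun i hi => ?_) fun a ha b hb e => ?_
        · simp only [Finset.coe_range, Set.mem_Iio] at hi ⊢
          exact hlt i hi j hj hjn
        · simp only [Finset.coe_range, Set.mem_Iio] at ha hb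
          exact hinj a (by omega) b (by omega) e
      simpa using hcard
    obtain ⟨r, hrn, hr⟩ := ih k hk f hsmall
      (fun i hi j hj => hinj i (by omega) j (by omega))
      (fun a b c hab hbc hc => hav a b c hab hbc (by omega))
    obtain ⟨l, hln, hl⟩ := ih (n - 1 - k) (by omega) (fun i => f (i + k + 1) - k)
      (fun i hi => by
        have h1 := hf (i + k + 1) (by omega)
        have h2 := hinj (i + k + 1) (by omega) k hk
        have := hlarge (i + k + 1) (by omega) (by omega)
        omega)
      (fun i hi j hj e => by
        have := hlarge (i + k + 1) (by omega) (by omega)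
        have := hlarge (j + k + 1) (by omega) (by omega)
        have := hinj (i + k + 1) (by omega) (j + k + 1) (by omega)
        omega)
      (fun a b c hab hbc hc => by
        have := hlarge (a + k + 1) (by omega) (by omega)
        have := hlarge (b + k + 1) (by omega) (by omega)
        have := hlarge (c + k + 1) (by omega) (by omega)
        have := hav (a + k + 1) (b + k + 1) (c + k + 1) (by omega) (by omega) (by omega)
        omega)
    refine ⟨.node () l r, by simp only [numNodes]; omega, fun i hi => ?_⟩
    simp only [treePerm, hrn, hln]
    split_ifs with h1 h2
    · exact hr i h1
    · subst h2
      omega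
    · rw [hl _ (by omega)]
      have := hlarge i (by omega) hi
      rw [show i - k - 1 + k + 1 = i by omega]
      omega

lemma descSum_treePerm_node (g : ℕ → ℕ) (a : Unit) (l r : BinaryTree Unit) :
    descSum g (treePerm (.node a l r)) (l.numNodes + r.numNodes + 1) =
      descSum g (treePerm r) r.numNodes
      + (if 0 < l.numNodes then g (r.numNodes + 1) else 0)
      + descSum (fun i => g (r.numNodes + (1 + i))) (treePerm l) l.numNodes := by
  rw [show l.numNodes + r.numNodes + 1 = r.numNodes + (1 + l.numNodes) by omega,
    descSum_add, descSum_add]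
  have h1 : descSum g (treePerm (.node a l r)) r.numNodes = descSum g (treePerm r) r.numNodes :=
    descSum_congr g 0 fun i hi => by simp [treePerm, hi]
  have h2 : ¬ (0 < r.numNodes ∧ 0 < 1 + l.numNodes ∧
      treePerm (.node a l r) r.numNodes < treePerm (.node a l r) (r.numNodes - 1)) := by
    rintro ⟨h, -, h'⟩
    have := treePerm_lt r (r.numNodes - 1) (by omega)
    simp [treePerm, h] at h'
    omega
  rw [h1, if_neg h2,
    descSum_congr (f' := treePerm l) (n := l.numNodes) _ r.numNodes fun i hi => by
      simp only [treePerm]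
      rw [if_neg (by omega), if_neg (by omega)]
      congr 2
      omega]
  have h3 : descSum (fun i => g (r.numNodes + i))
      (fun i => treePerm (.node a l r) (r.numNodes + i)) 1 = 0 := by simp [descSum]
  rw [h3, add_zero, zero_add, ← add_assoc]
  congr 2
  refine if_congr ⟨fun h => h.2.1, fun h => ⟨one_pos, h, ?_⟩⟩ rfl rfl
  have := treePerm_lt l 0 h
  simp only [treePerm, Nat.sub_self, add_zero, lt_irrefl, if_false, if_true]
  rw [if_neg (by omega), if_neg (by omega), show r.numNodes + 1 - r.numNodes - 1 = 0 by omega]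
  omega

lemma descSum_treePermInv_node (g : ℕ → ℕ) (a : Unit) (l r : BinaryTree Unit) :
    descSum g (treePermInv (.node a l r)) (l.numNodes + r.numNodes + 1) =
      descSum g (treePermInv r) r.numNodes
      + descSum (fun i => g (r.numNodes + i)) (treePermInv l) l.numNodes
      + (if 0 < l.numNodes then g (r.numNodes + l.numNodes) else 0) := by
  rw [show l.numNodes + r.numNodes + 1 = r.numNodes + (l.numNodes + 1) by omega,
    descSum_add, descSum_add]
  have h1 : descSum g (treePermInv (.node a l r)) r.numNodes =
      descSum g (treePermInv r) r.numNodes :=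
    descSum_congr g 0 fun i hi => by simp [treePermInv, hi]
  have h2 : ¬ (0 < r.numNodes ∧ 0 < l.numNodes + 1 ∧
      treePermInv (.node a l r) r.numNodes < treePermInv (.node a l r) (r.numNodes - 1)) := by
    rintro ⟨h, -, h'⟩
    have := treePermInv_lt r (r.numNodes - 1) (by omega)
    simp only [treePermInv, lt_irrefl, if_false] at h'
    rw [if_pos (show r.numNodes - 1 < r.numNodes by omega)] at h'
    split_ifs at h' <;> omega
  rw [h1, if_neg h2,
    descSum_congr (f' := treePermInv l) (n := l.numNodes) _ (r.numNodes + 1) fun i hi => by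
      simp only [treePermInv]
      rw [if_neg (by omega), if_neg (by omega), Nat.add_sub_cancel_left, add_assoc]]
  have h3 (g f : ℕ → ℕ) : descSum g f 1 = 0 := by simp [descSum]
  rw [h3, add_zero, add_zero, ← add_assoc]
  congr 1
  refine if_congr ⟨fun h => h.1, fun h => ⟨h, one_pos, ?_⟩⟩ rfl rfl
  simp only [treePermInv]
  rw [if_neg (by omega), if_pos (by omega), if_neg (by omega), if_neg (by omega)]
  omega

lemma invCount_treePerm_node (a : Unit) (l r : BinaryTree Unit) :
    invCount (treePerm (.node a l r)) (l.numNodes + r.numNodes + 1) =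
      invCount (treePerm r) r.numNodes + l.numNodes + invCount (treePerm l) l.numNodes := by
  rw [show l.numNodes + r.numNodes + 1 = r.numNodes + (1 + l.numNodes) by omega,
    invCount_add, invCount_add]
  have h1 : invCount (treePerm (.node a l r)) r.numNodes = invCount (treePerm r) r.numNodes :=
    invCount_congr 0 fun i hi => by simp [treePerm, hi]
  have h2 : invCount (fun i => treePerm (.node a l r) (r.numNodes + (1 + i))) l.numNodes =
      invCount (treePerm l) l.numNodes :=
    invCount_congr r.numNodes fun i hi => by
      simp only [treePerm]
      rw [if_neg (by omega), if_neg (by omega)]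
      congr 2
      omega
  have h3 : ∑ i ∈ Finset.range r.numNodes, ∑ j ∈ Finset.range (1 + l.numNodes),
      (if treePerm (.node a l r) (r.numNodes + j) < treePerm (.node a l r) i then 1 else 0)
      = 0 := by
    refine Finset.sum_eq_zero fun i hi => Finset.sum_eq_zero fun j hj => ?_
    have hi := Finset.mem_range.1 hi
    have := treePerm_lt r i hi
    rw [if_neg]
    simp only [treePerm, if_pos hi]
    split_ifs <;> omega
  have h4 : ∑ i ∈ Finset.range 1, ∑ j ∈ Finset.range l.numNodes,
      (if treePerm (.node a l r) (r.numNodes + (1 + j)) < treePerm (.node a l r) (r.numNodes + i)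
        then 1 else 0) = l.numNodes := by
    rw [Finset.sum_range_one, Finset.sum_congr rfl (g := fun _ => 1), Finset.sum_const]
    · simp
    intro j hj
    have := treePerm_lt l j (Finset.mem_range.1 hj)
    rw [if_pos]
    simp only [treePerm, add_zero, lt_irrefl, if_false, if_true]
    rw [if_neg (by omega), if_neg (by omega),
      show r.numNodes + (1 + j) - r.numNodes - 1 = j by omega]
    omega
  rw [h1, h2, h3, h4]
  simp [invCount, add_assoc]

/-- `treePerm t` as a permutation of `Fin n`. -/
noncomputable def treeEquivPerm {n : ℕ} (t : BinaryTree Unit) (ht : t.numNodes = n) :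
    Equiv.Perm (Fin n) where
  toFun i := ⟨treePerm t i, (treePerm_lt t i (i.2.trans_eq ht.symm)).trans_eq ht⟩
  invFun i := ⟨treePermInv t i, (treePermInv_lt t i (i.2.trans_eq ht.symm)).trans_eq ht⟩
  left_inv i := Fin.ext (treePermInv_treePerm t i (i.2.trans_eq ht.symm))
  right_inv i := Fin.ext (treePerm_treePermInv t i (i.2.trans_eq ht.symm))

lemma avoids231_treeEquivPerm {n : ℕ} (t : BinaryTree Unit) (ht : t.numNodes = n) :
    Avoids231 (treeEquivPerm t ht) := by
  rintro ⟨i, j, k, hij, hjk, h1, h2⟩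
  exact h2.not_gt (treePerm_avoids t i j k hij hjk (ht ▸ k.2) h1)

lemma exists_treeEquivPerm_eq {n : ℕ} (σ : Equiv.Perm (Fin n)) (hσ : Avoids231 σ) :
    ∃ (t : BinaryTree Unit) (ht : t.numNodes = n), treeEquivPerm t ht = σ := by
  let f : ℕ → ℕ := fun i => if h : i < n then σ ⟨i, h⟩ else 0
  have hf (i : ℕ) (h : i < n) : f i = σ ⟨i, h⟩ := dif_pos h
  obtain ⟨t, ht, h⟩ := exists_treePerm_eq n f (fun i hi => by simp [hf i hi])
    (fun i hi j hj e => by simpa [hf i hi, hf j hj, Fin.val_inj] using e)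
    (fun i j k hij hjk hk h => by
      have hj := hjk.trans hk
      have hi := hij.trans hj
      rw [hf k hk, hf i hi] at h
      rw [hf j hj, hf i hi]
      by_contra h'
      refine hσ ⟨⟨i, hi⟩, ⟨j, hj⟩, ⟨k, hk⟩, hij, hjk, h, lt_of_le_of_ne (not_lt.1 h') fun e => ?_⟩
      exact hij.ne (by simpa using e))
  exact ⟨t, ht, Equiv.ext fun i => Fin.ext ((h i i.2).trans (hf i i.2))⟩

end Permutations

section Words

open DyckStep BinaryTree

/-- Number of descents (a `D` followed by a `U`) of a word. -/
def wordDes : List DyckStep → ℕ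
  | [] => 0
  | a :: l => (if a = D ∧ l.head? = some U then 1 else 0) + wordDes l

/-- Sum over the descents of a word of the number of letters after the `D`. -/
def wordMaj : List DyckStep → ℕ
  | [] => 0
  | a :: l => (if a = D ∧ l.head? = some U then l.length else 0) + wordMaj l

/-- Sum of the heights at which the `U` letters of a word start, for a path starting at
height `h`. -/
def wordArea (h : ℤ) : List DyckStep → ℤ
  | [] => 0
  | U :: l => h + wordArea (h + 1) l
  | D :: l => wordArea (h - 1) l

lemma wordDes_append_D (l l' : List DyckStep) :
    wordDes (l ++ D :: l') = wordDes l + wordDes (D :: l') := by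
  induction l with
  | nil => simp [wordDes]
  | cons a l ih => cases l <;> simp_all [wordDes, add_assoc]

lemma wordMaj_append_D (l l' : List DyckStep) :
    wordMaj (l ++ D :: l') = wordMaj l + wordDes l * (l'.length + 1) + wordMaj (D :: l') := by
  induction l with
  | nil => simp [wordMaj, wordDes]
  | cons a l ih =>
    rw [List.cons_append, wordMaj, ih, wordMaj.eq_def (a :: l), wordDes.eq_def (a :: l)]
    cases l with
    | nil => simp
    | cons b l =>
      simp only [List.cons_append, List.head?_cons, List.length_append, List.length_cons]
      by_cases h : a = D ∧ some b = some U <;> simp only [h, and_self, if_true, if_false] <;> ring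

lemma wordArea_append (h : ℤ) (l l' : List DyckStep) :
    wordArea h (l ++ l') = wordArea h l + wordArea (h + l.count U - l.count D) l' := by
  induction l generalizing h with
  | nil => simp [wordArea]
  | cons a l ih =>
    cases a <;> simp [wordArea, ih, add_assoc] <;> ring_nf

lemma wordArea_add_one (h : ℤ) (l : List DyckStep) :
    wordArea (h + 1) l = wordArea h l + l.count U := by
  induction l generalizing h with
  | nil => simp [wordArea]
  | cons a l ih =>
    cases a
    · simp [wordArea, ih]
      ring
    · have := ih (h - 1)
      simp only [sub_add_cancel] at this
      simp [wordArea, this]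

lemma semilength_ofTree (t : BinaryTree Unit) : (DyckWord.ofTree t).semilength = t.numNodes := by
  rw [← DyckWord.numNodes_toTree, DyckWord.toTree_ofTree]

lemma count_U_ofTree (t : BinaryTree Unit) :
    (DyckWord.ofTree t).toList.count U = t.numNodes := semilength_ofTree t

lemma count_D_ofTree (t : BinaryTree Unit) :
    (DyckWord.ofTree t).toList.count D = t.numNodes := by
  rw [← DyckWord.count_U_eq_count_D, count_U_ofTree]

lemma length_ofTree (t : BinaryTree Unit) :
    (DyckWord.ofTree t).toList.length = 2 * t.numNodes := by
  rw [← DyckWord.two_mul_semilength_eq_length, semilength_ofTree]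

lemma toList_ofTree_node (a : Unit) (l r : BinaryTree Unit) :
    (DyckWord.ofTree (.node a l r)).toList =
      U :: ((DyckWord.ofTree l).toList ++ D :: (DyckWord.ofTree r).toList) := by
  change U :: _ ++ [D] ++ _ = _
  simp

lemma head?_toList_ofTree {t : BinaryTree Unit} (h : 0 < t.numNodes) :
    (DyckWord.ofTree t).toList.head? = some U := by
  cases t with
  | nil => simp at h
  | node a l r => simp [toList_ofTree_node]

lemma wordDes_D_ofTree (t : BinaryTree Unit) :
    wordDes (D :: (DyckWord.ofTree t).toList) =
      (if 0 < t.numNodes then 1 else 0) + wordDes (DyckWord.ofTree t).toList := by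
  cases t with
  | nil => rfl
  | node a l r => simp [toList_ofTree_node, wordDes]

lemma wordMaj_D_ofTree (t : BinaryTree Unit) :
    wordMaj (D :: (DyckWord.ofTree t).toList) =
      2 * t.numNodes + wordMaj (DyckWord.ofTree t).toList := by
  rw [wordMaj, length_ofTree]
  cases t with
  | nil => rfl
  | node a l r => simp [toList_ofTree_node]

lemma descSum_add_left (c : ℕ) (f : ℕ → ℕ) (n : ℕ) :
    descSum (fun i => c + i) f n = c * descSum (fun _ => 1) f n + descSum id f n := by
  simp only [descSum, Finset.mul_sum, ← Finset.sum_add_distrib]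
  refine Finset.sum_congr rfl fun i _ => ?_
  split_ifs <;> simp

lemma des_treePermInv (t : BinaryTree Unit) :
    descSum (fun _ => 1) (treePermInv t) t.numNodes =
      descSum (fun _ => 1) (treePerm t) t.numNodes := by
  induction t with
  | nil => rfl
  | node a l r hl hr =>
    rw [numNodes, descSum_treePermInv_node, descSum_treePerm_node, hl, hr]
    omega

lemma wordDes_add_des_treePerm (t : BinaryTree Unit) :
    wordDes (DyckWord.ofTree t).toList + descSum (fun _ => 1) (treePerm t) t.numNodes
      + (if 0 < t.numNodes then 1 else 0) = t.numNodes := by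
  induction t with
  | nil => simp [DyckWord.ofTree, wordDes, descSum]
  | node a l r hl hr =>
    rw [numNodes, descSum_treePerm_node, toList_ofTree_node, wordDes, wordDes_append_D,
      wordDes_D_ofTree]
    simp only [reduceCtorEq, false_and, if_false]
    split_ifs at * <;> omega

lemma wordMaj_add_maj_treePerm (t : BinaryTree Unit) :
    wordMaj (DyckWord.ofTree t).toList + descSum id (treePerm t) t.numNodes
      + descSum id (treePermInv t) t.numNodes + t.numNodes = t.numNodes * t.numNodes := by
  induction t with
  | nil => simp [DyckWord.ofTree, wordMaj, descSum]
  | node a l r hl hr =>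
    rw [numNodes, descSum_treePerm_node, descSum_treePermInv_node, toList_ofTree_node, wordMaj,
      wordMaj_append_D, wordMaj_D_ofTree, length_ofTree]
    have hd := wordDes_add_des_treePerm l
    simp only [id, ← add_assoc]
    rw [descSum_add_left, descSum_add_left, des_treePermInv]
    simp only [reduceCtorEq, false_and, if_false]
    generalize wordDes (DyckWord.ofTree l).toList = d at *
    generalize descSum (fun _ => 1) (treePerm l) l.numNodes = e at *
    generalize descSum id (treePerm l) l.numNodes = x at *
    generalize descSum id (treePermInv l) l.numNodes = y at *
    generalize l.numNodes = k at *
    split_ifs at * with h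
    · subst hd
      linarith
    · obtain rfl : k = 0 := by omega
      obtain rfl : d = 0 := by omega
      obtain rfl : e = 0 := by omega
      linarith

lemma wordArea_ofTree (t : BinaryTree Unit) :
    wordArea 0 (DyckWord.ofTree t).toList = invCount (treePerm t) t.numNodes := by
  induction t with
  | nil => simp [DyckWord.ofTree, wordArea, invCount]
  | node a l r hl hr =>
    rw [numNodes, invCount_treePerm_node, toList_ofTree_node, wordArea, wordArea_append,
      wordArea_add_one, wordArea, count_U_ofTree, count_D_ofTree, hl]
    simp [hr]
    ring

end Words

section Paths

open DyckStep

variable {m : ℕ} (w : Fin m → Bool)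

/-- The list of steps of a path. -/
def pathWord {m : ℕ} (w : Fin m → Bool) : List DyckStep :=
  List.ofFn fun i => if w i then U else D

@[simp]
lemma length_pathWord : (pathWord w).length = m := by simp [pathWord]

lemma pathWord_injective : Function.Injective (pathWord (m := m)) := by
  intro w w' h
  have := List.ofFn_injective h
  funext i
  have := congrFun this i
  cases h : w i <;> cases h' : w' i <;> simp_all

lemma take_succ_pathWord {k : ℕ} (hk : k < m) :
    (pathWord w).take (k + 1) = (pathWord w).take k ++ [if w ⟨k, hk⟩ then U else D] := by
  rw [List.take_succ_eq_append_getElem (by simpa using hk)]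
  simp [pathWord]

lemma countN_succ {k : ℕ} (hk : k < m) :
    countN w (k + 1) = countN w k + if w ⟨k, hk⟩ = true then 1 else 0 := by
  unfold countN
  simp only [Finset.card_filter]
  rw [← Finset.sum_ite_eq' Finset.univ (⟨k, hk⟩ : Fin m) (fun i => if w i = true then 1 else 0)
    |>.trans (if_pos (Finset.mem_univ _)), ← Finset.sum_add_distrib]
  refine Finset.sum_congr rfl fun i _ => ?_
  rcases lt_trichotomy (i : ℕ) k with h | h | h
  · simp [h, h.trans k.lt_succ_self, Fin.ext_iff, h.ne]
  · simp [h, Fin.ext_iff]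
  · simp [h.not_gt, Fin.ext_iff, h.ne', show ¬ (i : ℕ) < k + 1 by omega]

lemma countE_succ {k : ℕ} (hk : k < m) :
    countE w (k + 1) = countE w k + if w ⟨k, hk⟩ = false then 1 else 0 := by
  unfold countE
  simp only [Finset.card_filter]
  rw [← Finset.sum_ite_eq' Finset.univ (⟨k, hk⟩ : Fin m) (fun i => if w i = false then 1 else 0)
    |>.trans (if_pos (Finset.mem_univ _)), ← Finset.sum_add_distrib]
  refine Finset.sum_congr rfl fun i _ => ?_
  rcases lt_trichotomy (i : ℕ) k with h | h | h
  · simp [h, h.trans k.lt_succ_self, Fin.ext_iff, h.ne]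
  · simp [h, Fin.ext_iff]
  · simp [h.not_gt, Fin.ext_iff, h.ne', show ¬ (i : ℕ) < k + 1 by omega]

lemma countN_mono {k k' : ℕ} (h : k ≤ k') : countN w k ≤ countN w k' :=
  Finset.card_le_card fun i => by
    simp only [Finset.mem_filter, Finset.mem_univ, true_and]
    exact fun ⟨h1, h2⟩ => ⟨by omega, h2⟩

lemma countN_of_le {k : ℕ} (h : m ≤ k) : countN w k = countN w m := by
  unfold countN
  congr 1
  ext i
  have := i.2
  simp [show (i : ℕ) < k by omega]

lemma countE_of_le {k : ℕ} (h : m ≤ k) : countE w k = countE w m := by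
  unfold countE
  congr 1
  ext i
  have := i.2
  simp [show (i : ℕ) < k by omega]

lemma count_take_pathWord {k : ℕ} (hk : k ≤ m) :
    ((pathWord w).take k).count U = countN w k ∧ ((pathWord w).take k).count D = countE w k := by
  induction k with
  | zero => simp [countN, countE]
  | succ k ih =>
    obtain ⟨h1, h2⟩ := ih (by omega)
    rw [take_succ_pathWord w hk, countN_succ w hk, countE_succ w hk, List.count_append,
      List.count_append, h1, h2]
    cases w ⟨k, hk⟩ <;> simp

lemma count_take_pathWord_U (k : ℕ) : ((pathWord w).take k).count U = countN w k := by
  rcases le_total k m with h | h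
  · exact (count_take_pathWord w h).1
  · rw [countN_of_le w h, ← (count_take_pathWord w le_rfl).1, List.take_of_length_le (by simpa),
      List.take_of_length_le (by simp)]

lemma count_take_pathWord_D (k : ℕ) : ((pathWord w).take k).count D = countE w k := by
  rcases le_total k m with h | h
  · exact (count_take_pathWord w h).2
  · rw [countE_of_le w h, ← (count_take_pathWord w le_rfl).2, List.take_of_length_le (by simpa),
      List.take_of_length_le (by simp)]

lemma sum_descents_eq_wordMaj (l : List DyckStep) :
    ∑ i ∈ Finset.range l.length,
      (if l[i]? = some D ∧ l[i + 1]? = some U then l.length - (i + 1) else 0) = wordMaj l := by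
  induction l with
  | nil => rfl
  | cons a l ih =>
    rw [wordMaj, ← ih, List.length_cons, Finset.sum_range_succ', add_comm]
    congr 1
    · simp [List.head?_eq_getElem?]
    · simp

lemma sum_pathDes_eq_wordMaj : ∑ i ∈ pathDes w, (m - i) = wordMaj (pathWord w) := by
  rw [← sum_descents_eq_wordMaj, length_pathWord, ← Finset.sum_filter]
  refine Finset.sum_nbij' (fun i => i - 1) (fun i => i + 1) ?_ ?_ ?_ ?_ ?_
  · intro i hi
    simp only [pathDes, Finset.mem_filter, Finset.mem_Ioo] at hi
    obtain ⟨⟨h1, h2⟩, h3, h4, h5⟩ := hi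
    have : i - 1 < m := by omega
    simp [pathWord, List.getElem?_ofFn, this, Nat.sub_add_cancel h1, h2, h4, h5]
  · intro i hi
    simp only [pathWord, List.getElem?_ofFn, Finset.mem_filter, Finset.mem_range] at hi
    obtain ⟨h1, h2, h3⟩ := hi
    have h4 : i + 1 < m := by
      by_contra h
      simp [h] at h3
    rw [dif_pos h1] at h2
    rw [dif_pos h4] at h3
    simp only [pathDes, Finset.mem_filter, Finset.mem_Ioo]
    exact ⟨⟨i.succ_pos, h4⟩, h4, by simpa using h2, by simpa using h3⟩
  · intro i hi
    simp only [pathDes, Finset.mem_filter, Finset.mem_Ioo] at hi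
    omega
  · intro i _
    rfl
  · intro i hi
    simp only [pathDes, Finset.mem_filter, Finset.mem_Ioo] at hi
    rw [Nat.sub_add_cancel hi.1.1]

/-- The cells `(i, j)` with `i < j` lying below the first `k` steps of a path. -/
def cellsBelow {m : ℕ} (w : Fin m → Bool) (k : ℕ) : Set (ℕ × ℕ) :=
  {p | 1 ≤ p.1 ∧ p.1 < p.2 ∧ ∃ k' ≤ k, countE w k' < p.1 ∧ p.2 ≤ countN w k'}

lemma cellsBelow_finite (k : ℕ) : (cellsBelow w k).Finite := by
  refine ((Finset.range (countN w k + 1) ×ˢ Finset.range (countN w k + 1)).finite_toSet).subset ?_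
  rintro ⟨i, j⟩ ⟨h1, h2, k', h3, h4, h5⟩
  have := countN_mono w h3
  simp only [Finset.coe_product, Finset.coe_range, Set.mem_prod, Set.mem_Iio]
  dsimp only at *
  omega

lemma cellsBelow_succ {k : ℕ} (hk : k < m) :
    cellsBelow w (k + 1) = cellsBelow w k ∪
      ((if w ⟨k, hk⟩ then Finset.Ioo (countE w k) (countN w k + 1) ×ˢ {countN w k + 1} else ∅ :
        Finset (ℕ × ℕ)) : Set (ℕ × ℕ)) := by
  have hN := countN_succ w hk
  have hE := countE_succ w hk
  ext ⟨i, j⟩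
  cases h : w ⟨k, hk⟩ <;> simp only [h] at hN hE ⊢
  · simp only [cellsBelow, Set.mem_union, Set.mem_ofPred_eq]
    simp at hN hE ⊢
    intro h1 h2
    constructor
    · rintro ⟨k', h3, h4, h5⟩
      rcases h3.lt_or_eq with h3 | rfl
      · exact ⟨k', by omega, h4, h5⟩
      · exact ⟨k, le_rfl, by omega, by omega⟩
    · rintro ⟨k', h3, h4, h5⟩
      exact ⟨k', by omega, h4, h5⟩
  · simp only [cellsBelow, Set.mem_union, Set.mem_ofPred_eq]
    simp at hN hE ⊢
    constructor
    · rintro ⟨h1, h2, k', h3, h4, h5⟩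
      rcases h3.lt_or_eq with h3 | rfl
      · exact .inl ⟨h1, h2, k', by omega, h4, h5⟩
      · by_cases hj : j = countN w k + 1
        · exact .inr ⟨⟨by omega, by omega⟩, hj.symm⟩
        · exact .inl ⟨h1, h2, k, le_rfl, by omega, by omega⟩
    · rintro (⟨h1, h2, k', h3, h4, h5⟩ | ⟨⟨h1, h2⟩, h3⟩)
      · exact ⟨h1, h2, k', by omega, h4, h5⟩
      · exact ⟨by omega, by omega, k + 1, le_rfl, by omega, by omega⟩

lemma ncard_cellsBelow (hw : ∀ k, countE w k ≤ countN w k) {k : ℕ} (hk : k ≤ m) :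
    ((cellsBelow w k).ncard : ℤ) = wordArea 0 ((pathWord w).take k) := by
  induction k with
  | zero =>
    have : cellsBelow w 0 = ∅ := by
      ext ⟨i, j⟩
      simp only [cellsBelow, Set.mem_ofPred_eq, Set.mem_empty_iff_false, iff_false]
      rintro ⟨h1, h2, k, h3, h4, h5⟩
      obtain rfl : k = 0 := by omega
      simp [countN] at h5
      omega
    simp [this, wordArea]
  | succ k ih =>
    have hk' : k < m := hk
    rw [take_succ_pathWord w hk', wordArea_append, ← ih hk'.le, count_take_pathWord_U,
      count_take_pathWord_D, cellsBelow_succ w hk', Set.ncard_union_eq _ (cellsBelow_finite w k)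
        (Finset.finite_toSet _), Set.ncard_coe_finset]
    · have := hw k
      cases w ⟨k, hk'⟩ <;> simp [wordArea]
      omega
    · rw [Set.disjoint_left]
      rintro ⟨i, j⟩ ⟨h1, h2, k', h3, h4, h5⟩ h
      have := countN_mono w h3
      split_ifs at h
      · simp at h
        dsimp only at *
        omega
      · simp at h

lemma areaA_eq_wordArea (hw : ∀ k, countE w k ≤ countN w k) :
    (areaA w : ℤ) = wordArea 0 (pathWord w) := by
  have h := ncard_cellsBelow w hw le_rfl
  rw [List.take_of_length_le (by simp)] at h
  rw [← h, areaA]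
  congr 2
  ext ⟨i, j⟩
  simp only [cellsBelow, CellBelow, Set.mem_ofPred_eq]
  refine and_congr_right fun _ => and_congr_right fun _ => ⟨?_, ?_⟩
  · rintro ⟨k, h1, h2⟩
    rcases le_total k m with h | h
    · exact ⟨k, h, h1, h2⟩
    · exact ⟨m, le_rfl, countE_of_le w h ▸ h1, countN_of_le w h ▸ h2⟩
  · rintro ⟨k, -, h⟩
    exact ⟨k, h⟩

lemma count_U_add_count_D (l : List DyckStep) : l.count U + l.count D = l.length := by
  induction l with
  | nil => rfl
  | cons a l ih => cases a <;> simp <;> omega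

lemma count_U_pathWord : (pathWord w).count U = countN w m := by
  rw [← count_take_pathWord_U, List.take_of_length_le (by simp)]

/-- The Dyck word of a Dyck path. -/
def dyckWordOfPath {n : ℕ} (w : {w : Fin (2 * n) → Bool // IsDyckA n w}) : DyckWord where
  toList := pathWord w.1
  count_U_eq_count_D := by
    have h1 := count_U_add_count_D (pathWord w.1)
    have h2 := count_U_pathWord w.1
    have h3 := w.2.1
    rw [length_pathWord] at h1
    omega
  count_D_le_count_U i := by
    rw [count_take_pathWord_U, count_take_pathWord_D]
    exact w.2.2 i

lemma semilength_dyckWordOfPath {n : ℕ} (w : {w : Fin (2 * n) → Bool // IsDyckA n w}) :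
    (dyckWordOfPath w).semilength = n :=
  (count_U_pathWord w.1).trans w.2.1

lemma dyckWordOfPath_injective {n : ℕ} : Function.Injective (dyckWordOfPath (n := n)) :=
  fun _ _ h => Subtype.ext (pathWord_injective (congrArg DyckWord.toList h))

lemma exists_dyckWordOfPath_eq {n : ℕ} (p : DyckWord) (hp : p.semilength = n) :
    ∃ w : {w : Fin (2 * n) → Bool // IsDyckA n w}, dyckWordOfPath w = p := by
  have hlen : p.toList.length = 2 * n := by rw [← p.two_mul_semilength_eq_length, hp]
  let w : Fin (2 * n) → Bool := fun i => decide (p.toList[(i : ℕ)]'(hlen.symm ▸ i.2) = U)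
  have hw : pathWord w = p.toList := by
    refine List.ext_getElem (by simp [hlen]) fun i h1 h2 => ?_
    cases h : p.toList[i] <;> simp [pathWord, w, h]
  refine ⟨⟨w, ?_, fun k => ?_⟩, DyckWord.ext hw⟩
  · rw [← count_U_pathWord, hw]
    exact hp
  · rw [← count_take_pathWord_U, ← count_take_pathWord_D, hw]
    exact p.count_D_le_count_U k

end Paths

/-- For every `n ≥ 1` there is a bijection `γ` from Dyck paths of length `n`
onto 231-avoiding permutations of `{1,…,n}` such that `area(w) = inv(γ(w))`
and `maj(w) + maj(γ(w)) + imaj(γ(w)) = n(n-1)`. -/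
theorem exists_bijection_dyck_231 (n : ℕ) (hn : 1 ≤ n) :
    ∃ γ : {w : Fin (2 * n) → Bool // IsDyckA n w} →
        {σ : Equiv.Perm (Fin n) // Avoids231 σ},
      Function.Bijective γ ∧ ∀ w,
        areaA w.1 = invP (γ w).1 ∧
        majA n w.1 + majP (γ w).1 + imajP (γ w).1 = n * (n - 1) := by
  let T (w : {w : Fin (2 * n) → Bool // IsDyckA n w}) := (dyckWordOfPath w).toTree
  have hT (w) : (T w).numNodes = n := by
    rw [DyckWord.numNodes_toTree, semilength_dyckWordOfPath]
  have hword (w) : (DyckWord.ofTree (T w)).toList = pathWord w.1 := by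
    rw [DyckWord.ofTree_toTree]
    rfl
  refine ⟨fun w => ⟨treeEquivPerm (T w) (hT w), avoids231_treeEquivPerm _ _⟩, ⟨?_, ?_⟩, ?_⟩
  · intro w w' h
    have h (i : ℕ) (hi : i < n) : treePerm (T w) i = treePerm (T w') i :=
      congrArg Fin.val (DFunLike.congr_fun (Subtype.ext_iff.1 h) (⟨i, hi⟩ : Fin n))
    have := treePerm_injective ((hT w).trans (hT w').symm) fun i hi => h i (hT w ▸ hi)
    exact dyckWordOfPath_injective (DyckWord.equivTree.injective this)
  · rintro ⟨σ, hσ⟩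
    obtain ⟨t, ht, rfl⟩ := exists_treeEquivPerm_eq σ hσ
    obtain ⟨w, hw⟩ := exists_dyckWordOfPath_eq (DyckWord.ofTree t)
      ((semilength_ofTree t).trans ht)
    have hwt : T w = t := by rw [← DyckWord.toTree_ofTree t, ← hw]
    refine ⟨w, Subtype.ext ?_⟩
    simp only [hwt]
  · intro w
    have hN := hT w
    constructor
    · have h1 := areaA_eq_wordArea w.1 w.2.2
      rw [← hword, wordArea_ofTree, hN] at h1
      rw [invP_eq_invCount (f := treePerm (T w)) fun _ => rfl]
      exact_mod_cast h1
    · have h1 := wordMaj_add_maj_treePerm (T w)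
      rw [imajP, majP_eq_descSum (f := treePerm (T w)) fun _ => rfl,
        majP_eq_descSum (f := treePermInv (T w)) fun _ => rfl, majA, sum_pathDes_eq_wordMaj,
        ← hword, Nat.mul_sub_one]
      rw [hN] at h1
      omega

end Stmt
end
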